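/- arXiv:2208.11775 — 5 statements merged into one kernel-verified Lean document; each statement's English description precedes it below -/
import Mathlib

section
/- Let ε = {ε_Q}_{Q∈𝒟} be a collection of positive real numbers indexed by the dyadic cubes of ℝⁿ, bounded above and with the domination property, and let p be an exponent function with 1 < p_- ≤ p_+ < ∞ and p ∈ εLH_0(ℝⁿ). Then there exists a constant C = C(n, p(·), ε) such that for every nonnegative measurable f with ∫_{ℝⁿ} f(x)^{p(x)} dx ≤ 1 and with f(x) > 1 for a.e. x where f(x) ≠ 0, one has ∫_{ℝⁿ} (M_ε f(x))^{p(x)} dx ≤ C. -/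
open MeasureTheory Set ENNReal

noncomputable section

/-- The dyadic cube in `ℝⁿ` with side length `2^(-k)` and lower-left corner `2^(-k) • m`. -/
def dyadicCube (n : ℕ) (k : ℤ) (m : Fin n → ℤ) : Set (Fin n → ℝ) :=
  {x | ∀ i, (2 : ℝ) ^ (-k) * m i ≤ x i ∧ x i < (2 : ℝ) ^ (-k) * (m i + 1)}

/-- `Q` is a dyadic cube in `ℝⁿ`. -/
def IsDyadicCube (n : ℕ) (Q : Set (Fin n → ℝ)) : Prop :=
  ∃ (k : ℤ) (m : Fin n → ℤ), Q = dyadicCube n k m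

/-- `ε_Q` times the average of `|f|` over `Q`. -/
def epsAvg (n : ℕ) (ε : Set (Fin n → ℝ) → ℝ) (f : (Fin n → ℝ) → ℝ)
    (Q : Set (Fin n → ℝ)) : ℝ :=
  ε Q * (((volume Q).toReal)⁻¹ * ∫ y in Q, |f y| ∂volume)

/-- The ε-maximal operator `M_ε f (x) = sup_{Q ∈ 𝒟, x ∈ Q} ε_Q ⨍_Q |f|`. -/
def epsMax (n : ℕ) (ε : Set (Fin n → ℝ) → ℝ) (f : (Fin n → ℝ) → ℝ)
    (x : Fin n → ℝ) : ℝ :=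
  sSup {r : ℝ | ∃ Q, IsDyadicCube n Q ∧ x ∈ Q ∧ r = epsAvg n ε f Q}

theorem measurable_finsetSup_indicator {α ι : Type*} [MeasurableSpace α] {Q : ι → Set α}
    (hQ : ∀ i, MeasurableSet (Q i)) (a : ι → NNReal) (S : Finset ι) :
    Measurable fun x => S.sup fun i => (Q i).indicator (fun _ => a i) x := by
  classical
  induction S using Finset.induction_on with
  | empty => simp
  | insert i S _ ih =>
    simp only [Finset.sup_insert]
    exact (measurable_const.indicator (hQ i)).max ih

theorem measure_biUnion_le_of_laminar {α ι : Type*} [MeasurableSpace α] {μ ν : Measure α}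
    {Q : ι → Set α} (hQ : ∀ i, MeasurableSet (Q i))
    (hlam : ∀ i j, Q i ⊆ Q j ∨ Q j ⊆ Q i ∨ Disjoint (Q i) (Q j)) (S : Finset ι)
    (h : ∀ i ∈ S, μ (Q i) ≤ ν (Q i)) : μ (⋃ i ∈ S, Q i) ≤ ν (⋃ i ∈ S, Q i) := by
  classical
  induction S using Finset.strongInduction with
  | H S ih =>
    rcases S.eq_empty_or_nonempty with rfl | ⟨a, ha⟩
    · simp
    by_cases hc : ∃ j ∈ S.erase a, Q a ⊆ Q j
    · obtain ⟨j, hj, haj⟩ := hc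
      have hU : (⋃ i ∈ S, Q i) = ⋃ i ∈ S.erase a, Q i := by
        rw [← Finset.insert_erase ha, Finset.set_biUnion_insert, Finset.erase_insert_eq_erase,
          Finset.erase_idem]
        exact union_eq_right.2 (haj.trans (subset_biUnion_of_mem (u := Q) hj))
      rw [hU]
      exact ih _ (Finset.erase_ssubset ha) fun i hi => h i (Finset.mem_of_mem_erase hi)
    · push Not at hc
      set T := (S.erase a).filter fun i => Disjoint (Q a) (Q i) with hT
      have hTS : T ⊆ S.erase a := Finset.filter_subset _ _
      have hU : (⋃ i ∈ S, Q i) = Q a ∪ ⋃ i ∈ T, Q i := by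
        apply Subset.antisymm
        · refine iUnion₂_subset fun i hi => ?_
          by_cases hia : i = a
          · subst hia; exact subset_union_left
          have hi' : i ∈ S.erase a := Finset.mem_erase.2 ⟨hia, hi⟩
          rcases hlam a i with h1 | h1 | h1
          · exact absurd h1 (hc i hi')
          · exact h1.trans subset_union_left
          · exact (subset_biUnion_of_mem (u := Q)
              (Finset.mem_filter.2 ⟨hi', h1⟩)).trans subset_union_right
        · refine union_subset (subset_biUnion_of_mem (u := Q) ha) ?_
          exact biUnion_subset_biUnion_left fun i hi => Finset.mem_of_mem_erase (hTS hi)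
      have hd : Disjoint (Q a) (⋃ i ∈ T, Q i) :=
        disjoint_iUnion₂_right.2 fun i hi => (Finset.mem_filter.1 hi).2
      have hm : MeasurableSet (⋃ i ∈ T, Q i) := Finset.measurableSet_biUnion _ fun i _ => hQ i
      rw [hU, measure_union hd hm, measure_union hd hm]
      refine add_le_add (h a ha) (ih T (hTS.trans_ssubset (Finset.erase_ssubset ha)) fun i hi => ?_)
      exact h i (Finset.mem_of_mem_erase (hTS hi))

theorem lintegral_sup_indicator_rpow_le {α ι : Type*} [MeasurableSpace α] {μ : Measure α}
    {Q : ι → Set α} (hQ : ∀ i, MeasurableSet (Q i)) (hfin : ∀ i, μ (Q i) ≠ ∞)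
    (hlam : ∀ i j, Q i ⊆ Q j ∨ Q j ⊆ Q i ∨ Disjoint (Q i) (Q j))
    {F : α → ℝ} (hF : Measurable F) (hF0 : ∀ x, 0 ≤ F x) {a : ι → NNReal}
    (ha : ∀ i, a i * μ (Q i) ≤ ∫⁻ x in Q i, ENNReal.ofReal (F x) ∂μ)
    {s : ℝ} (hs : 1 < s) (S : Finset ι) :
    ∫⁻ x, ENNReal.ofReal (((S.sup fun i => (Q i).indicator (fun _ => a i) x : NNReal) : ℝ) ^ s) ∂μ
      ≤ ENNReal.ofReal (s * 2 ^ s / (s - 1)) * ∫⁻ x, ENNReal.ofReal (F x ^ s) ∂μ := by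
  set ν := μ.withDensity fun x => ENNReal.ofReal (F x) with hν
  have hFm : Measurable fun x => ENNReal.ofReal (F x) := hF.ennreal_ofReal
  set G : α → NNReal := fun x => S.sup fun i => (Q i).indicator (fun _ => a i) x with hG
  have hGm : Measurable G :=
    measurable_finsetSup_indicator hQ a S
  have hweak : ∀ t : ℝ, 0 < t →
      μ {x | t < (G x : ℝ)} ≤ ENNReal.ofReal (2 * t⁻¹) * ν {x | t < 2 * F x} := by
    intro t ht
    classical
    set T := S.filter fun i => t < (a i : ℝ) with hT
    have hE : {x | t < (G x : ℝ)} = ⋃ i ∈ T, Q i := by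
      ext x
      simp only [mem_ofPred_eq, mem_iUnion, hG, hT, Finset.mem_filter, exists_prop]
      have h1 : t < ((S.sup fun i => (Q i).indicator (fun _ => a i) x : NNReal) : ℝ) ↔
          t.toNNReal < S.sup fun i => (Q i).indicator (fun _ => a i) x := by
        rw [Real.toNNReal_lt_iff_lt_coe ht.le]
      rw [h1, Finset.lt_sup_iff]
      constructor
      · rintro ⟨i, hi, hlt⟩
        by_cases hx : x ∈ Q i
        · rw [indicator_of_mem hx, Real.toNNReal_lt_iff_lt_coe ht.le] at hlt
          exact ⟨i, ⟨hi, hlt⟩, hx⟩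
        · rw [indicator_of_notMem hx] at hlt
          exact absurd hlt not_lt_zero
      · rintro ⟨i, ⟨hi, hlt⟩, hx⟩
        refine ⟨i, hi, ?_⟩
        rwa [indicator_of_mem hx, Real.toNNReal_lt_iff_lt_coe ht.le]
    rw [hE]
    set E := ⋃ i ∈ T, Q i with hEdef
    have hEm : MeasurableSet E := Finset.measurableSet_biUnion _ fun i _ => hQ i
    have hEfin : μ E ≠ ∞ := (measure_biUnion_lt_top T.finite_toSet
      fun i _ => (hfin i).lt_top).ne
    have h1 : ENNReal.ofReal t * μ E ≤ ν E := by
      have := measure_biUnion_le_of_laminar (μ := ENNReal.ofReal t • μ) (ν := ν) hQ hlam T ?_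
      · simpa using this
      · intro i hi
        rw [Measure.smul_apply, smul_eq_mul, hν, withDensity_apply _ (hQ i)]
        refine le_trans ?_ (ha i)
        gcongr
        rw [← ENNReal.ofReal_coe_nnreal]
        exact ENNReal.ofReal_le_ofReal (Finset.mem_filter.1 hi).2.le
    have hAm : MeasurableSet {x | t < 2 * F x} := measurableSet_lt measurable_const (hF.const_mul 2)
    have h2 : ν E ≤ ν {x | t < 2 * F x} + ENNReal.ofReal (t / 2) * μ E := by
      calc ν E ≤ ν ({x | t < 2 * F x} ∪ (E \ {x | t < 2 * F x})) :=
            measure_mono (by rw [union_sdiff_self]; exact subset_union_right)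
        _ ≤ ν {x | t < 2 * F x} + ν (E \ {x | t < 2 * F x}) := measure_union_le _ _
        _ ≤ _ := by
          gcongr
          rw [hν, withDensity_apply _ (hEm.diff hAm)]
          calc ∫⁻ x in E \ {x | t < 2 * F x}, ENNReal.ofReal (F x) ∂μ
              ≤ ∫⁻ x in E \ {x | t < 2 * F x}, ENNReal.ofReal (t / 2) ∂μ := by
                refine setLIntegral_mono measurable_const fun x hx => ?_
                have := hx.2
                simp only [mem_ofPred_eq, not_lt] at this
                exact ENNReal.ofReal_le_ofReal (by linarith)
            _ = ENNReal.ofReal (t / 2) * μ (E \ {x | t < 2 * F x}) := by simp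
            _ ≤ _ := by gcongr; exact sdiff_subset
    have h3 : ENNReal.ofReal (t / 2) * μ E ≤ ν {x | t < 2 * F x} := by
      have h4 : ENNReal.ofReal t * μ E =
          ENNReal.ofReal (t / 2) * μ E + ENNReal.ofReal (t / 2) * μ E := by
        rw [← add_mul, ← ENNReal.ofReal_add (by positivity) (by positivity)]
        ring_nf
      have h5 := h1.trans h2
      rw [h4] at h5
      exact (ENNReal.add_le_add_iff_right (mul_ne_top ofReal_ne_top hEfin)).1 h5
    calc μ E = ENNReal.ofReal (2 * t⁻¹) * (ENNReal.ofReal (t / 2) * μ E) := by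
          rw [← mul_assoc, ← ENNReal.ofReal_mul (by positivity),
            show 2 * t⁻¹ * (t / 2) = 1 by field_simp, ENNReal.ofReal_one, one_mul]
      _ ≤ _ := by gcongr
  rw [lintegral_rpow_eq_lintegral_meas_lt_mul μ (f := fun x => (G x : ℝ))
    (Filter.Eventually.of_forall fun x => (G x).2) (by fun_prop) (by linarith)]
  have hν2 := lintegral_rpow_eq_lintegral_meas_lt_mul ν (f := fun x => 2 * F x)
    (Filter.Eventually.of_forall fun x => mul_nonneg zero_le_two (hF0 x))
    (hF.const_mul 2).aemeasurable (p := s - 1) (by linarith)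
  have hν3 : ∫⁻ x, ENNReal.ofReal ((2 * F x) ^ (s - 1)) ∂ν =
      ENNReal.ofReal (2 ^ (s - 1)) * ∫⁻ x, ENNReal.ofReal (F x ^ s) ∂μ := by
    rw [hν, lintegral_withDensity_eq_lintegral_mul _ hFm (by fun_prop),
      ← lintegral_const_mul _ (by fun_prop)]
    refine lintegral_congr fun x => ?_
    rw [Pi.mul_apply, ← ENNReal.ofReal_mul (hF0 x), ← ENNReal.ofReal_mul (by positivity)]
    congr 1
    rw [Real.mul_rpow zero_le_two (hF0 x)]
    have : F x ^ s = F x * F x ^ (s - 1) := by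
      conv_rhs => rw [← Real.rpow_one_add' (hF0 x) (by linarith)]
      ring_nf
    rw [this]; ring
  calc ENNReal.ofReal s * ∫⁻ t in Ioi (0 : ℝ),
        μ {x | t < (G x : ℝ)} * ENNReal.ofReal (t ^ (s - 1))
      ≤ ENNReal.ofReal s * ∫⁻ t in Ioi (0 : ℝ),
        ENNReal.ofReal 2 * (ν {x | t < 2 * F x} * ENNReal.ofReal (t ^ (s - 1 - 1))) := by
        gcongr ENNReal.ofReal s * ?_
        refine setLIntegral_mono' measurableSet_Ioi fun t ht => ?_
        have ht : 0 < t := ht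
        calc _ ≤ ENNReal.ofReal (2 * t⁻¹) * ν {x | t < 2 * F x} * ENNReal.ofReal (t ^ (s - 1)) := by
              gcongr; exact hweak t ht
          _ = _ := by
              rw [Real.rpow_sub_one ht.ne' (s - 1), div_eq_inv_mul,
                ENNReal.ofReal_mul zero_le_two, ENNReal.ofReal_mul (inv_nonneg.2 ht.le)]
              ring
    _ = ENNReal.ofReal s * (ENNReal.ofReal 2 * ∫⁻ t in Ioi (0 : ℝ),
          ν {x | t < 2 * F x} * ENNReal.ofReal (t ^ (s - 1 - 1))) := by
        rw [lintegral_const_mul' _ _ ofReal_ne_top]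
    _ = ENNReal.ofReal (2 * s / (s - 1)) * ∫⁻ x, ENNReal.ofReal ((2 * F x) ^ (s - 1)) ∂ν := by
        have hs1 : s - 1 ≠ 0 := by linarith
        rw [hν2, ← mul_assoc, ← mul_assoc, ← ENNReal.ofReal_mul (by linarith),
          ← ENNReal.ofReal_mul (div_nonneg (by linarith) (by linarith))]
        congr 2
        field_simp
    _ = _ := by
        rw [hν3, ← mul_assoc, ← ENNReal.ofReal_mul (div_nonneg (by linarith) (by linarith)),
          Real.rpow_sub_one two_ne_zero]
        congr 2
        ring

theorem rpow_laverage_le_of_le_rpow {α : Type*} [MeasurableSpace α] {μ : Measure α}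
    (h0 : μ univ ≠ 0) (hfin : μ univ ≠ ∞) {g h : α → ℝ≥0∞} (hh : AEMeasurable h μ)
    {s q : ℝ} (hs : 0 < s) (hsq : s ≤ q) (hgh : ∀ᵐ x ∂μ, g x ≤ h x ^ (s / q)) :
    (⨍⁻ x, g x ∂μ) ^ q ≤ (⨍⁻ x, h x ∂μ) ^ s := by
  have hq : 0 < q := hs.trans_le hsq
  have : NeZero μ := ⟨fun h => h0 (by simp [h])⟩
  have : IsFiniteMeasure μ := ⟨hfin.lt_top⟩
  set μ' := (μ univ)⁻¹ • μ with hμ'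
  have hac : μ' ≪ μ := Measure.smul_absolutelyContinuous
  have hθ : 0 < s / q := by positivity
  have key := eLpNorm'_le_eLpNorm'_of_exponent_le (μ := μ') hθ
    ((div_le_one hq).2 hsq) (f := h) (hh.mono_ac hac).aestronglyMeasurable
  simp only [eLpNorm', enorm_eq_self, ENNReal.rpow_one, div_one] at key
  calc (∫⁻ x, g x ∂μ') ^ q ≤ (∫⁻ x, h x ^ (s / q) ∂μ') ^ q := by
        gcongr ?_ ^ q
        exact lintegral_mono_ae (hac.ae_le hgh)
    _ = ((∫⁻ x, h x ^ (s / q) ∂μ') ^ (1 / (s / q))) ^ s := by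
        rw [← ENNReal.rpow_mul]; congr 1; field_simp
    _ ≤ _ := by gcongr ?_ ^ s; exact key

theorem mul_rpow_le_of_rpow_le {v e B A q r t P C X : ℝ} (hv : 0 < v) (he : 0 < e)
    (heB : e ≤ B) (hB : 1 ≤ B) (hA : 0 ≤ A) (hAv : A ≤ v⁻¹) (hq : 1 ≤ q) (hqt : q ≤ t)
    (htr : t ≤ r) (htP : t ≤ P) (hC : (v / e) ^ (q - r) ≤ C) (hX : A ^ q ≤ X) :
    (e * A) ^ t ≤ B ^ P * max 1 C * X := by
  have h1 : (e * A) ^ q ≤ B ^ P * X := by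
    rw [Real.mul_rpow he.le hA]
    gcongr
    calc e ^ q ≤ B ^ q := by gcongr
      _ ≤ B ^ P := Real.rpow_le_rpow_of_exponent_le hB (hqt.trans htP)
  have h2 : (e * A) ^ (t - q) ≤ max 1 C := by
    have h3 : (e * A) ^ (t - q) ≤ (e * v⁻¹) ^ (t - q) := by
      have : 0 ≤ t - q := by linarith
      gcongr
    refine h3.trans ?_
    rcases le_total (e * v⁻¹) 1 with h | h
    · exact (Real.rpow_le_one (by positivity) h (by linarith)).trans (le_max_left _ _)
    · refine le_trans ?_ (hC.trans (le_max_right _ _))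
      have : v / e = (e * v⁻¹)⁻¹ := by field_simp
      rw [this, Real.inv_rpow (by positivity), ← Real.rpow_neg (by positivity)]
      exact Real.rpow_le_rpow_of_exponent_le h (by linarith)
  have h4 : (e * A) ^ t = (e * A) ^ q * (e * A) ^ (t - q) := by
    rw [← Real.rpow_add_of_nonneg (by positivity) (by linarith) (by linarith)]
    ring_nf
  have hX0 : 0 ≤ X := (Real.rpow_nonneg hA q).trans hX
  calc _ ≤ (B ^ P * X) * max 1 C := by rw [h4]; gcongr
    _ = _ := by ring

theorem dyadicCube_eq_pi (n : ℕ) (k : ℤ) (m : Fin n → ℤ) :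
    dyadicCube n k m =
      univ.pi fun i => Ico ((2 : ℝ) ^ (-k) * m i) ((2 : ℝ) ^ (-k) * (m i + 1)) := by
  ext x; simp [dyadicCube, mem_pi]

theorem measurableSet_dyadicCube (n : ℕ) (k : ℤ) (m : Fin n → ℤ) :
    MeasurableSet (dyadicCube n k m) := by
  rw [dyadicCube_eq_pi]
  exact MeasurableSet.univ_pi fun i => measurableSet_Ico

theorem volume_dyadicCube_ne_top (n : ℕ) (k : ℤ) (m : Fin n → ℤ) :
    volume (dyadicCube n k m) ≠ ∞ := by
  rw [dyadicCube_eq_pi, volume_pi_pi]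
  exact ENNReal.prod_ne_top fun i _ => by simp

theorem volume_dyadicCube_ne_zero (n : ℕ) (k : ℤ) (m : Fin n → ℤ) :
    volume (dyadicCube n k m) ≠ 0 := by
  rw [dyadicCube_eq_pi, volume_pi_pi, Finset.prod_ne_zero_iff]
  intro i _
  rw [Real.volume_Ico, Ne, ENNReal.ofReal_eq_zero, not_le]
  have : (0 : ℝ) < 2 ^ (-k) := by positivity
  linarith

theorem dyadicCube_subset_of_mem {n : ℕ} {k l : ℤ} (hkl : k ≤ l) {m m' : Fin n → ℤ}
    {x : Fin n → ℝ} (hx : x ∈ dyadicCube n k m) (hx' : x ∈ dyadicCube n l m') :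
    dyadicCube n l m' ⊆ dyadicCube n k m := by
  obtain ⟨j, rfl⟩ := Int.le.dest hkl
  have hc : (2 : ℝ) ^ (-k) = 2 ^ (-(k + (j : ℤ))) * ((2 ^ j : ℤ) : ℝ) := by
    push_cast
    rw [← zpow_natCast, ← zpow_add₀ two_ne_zero]
    ring_nf
  have hd : (0 : ℝ) < 2 ^ (-(k + (j : ℤ))) := by positivity
  intro y hy i
  obtain ⟨h1, h2⟩ := hx i
  obtain ⟨h3, h4⟩ := hx' i
  obtain ⟨h5, h6⟩ := hy i
  rw [hc, mul_assoc] at h1 h2 ⊢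
  have h7 : 2 ^ j * m i < m' i + 1 := by
    have := (mul_lt_mul_iff_right₀ hd).1 (h1.trans_lt h4)
    exact_mod_cast this
  have h8 : m' i < 2 ^ j * (m i + 1) := by
    have := (mul_lt_mul_iff_right₀ hd).1 (h3.trans_lt h2)
    exact_mod_cast this
  have h9 : (((2 ^ j : ℤ) : ℝ)) * m i ≤ m' i := by exact_mod_cast Int.lt_add_one_iff.1 h7
  have h10 : (m' i : ℝ) + 1 ≤ (((2 ^ j : ℤ) : ℝ)) * (m i + 1) := by
    exact_mod_cast Int.add_one_le_iff.2 h8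
  rw [mul_assoc]
  exact ⟨(mul_le_mul_of_nonneg_left h9 hd.le).trans h5,
    h6.trans_le (mul_le_mul_of_nonneg_left h10 hd.le)⟩

theorem dyadicCube_laminar {n : ℕ} (k l : ℤ) (m m' : Fin n → ℤ) :
    dyadicCube n k m ⊆ dyadicCube n l m' ∨ dyadicCube n l m' ⊆ dyadicCube n k m ∨
      Disjoint (dyadicCube n k m) (dyadicCube n l m') := by
  by_cases h : Disjoint (dyadicCube n k m) (dyadicCube n l m')
  · exact .inr (.inr h)
  obtain ⟨x, hx, hx'⟩ := not_disjoint_iff.1 h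
  rcases le_total k l with hkl | hkl
  · exact .inr (.inl (dyadicCube_subset_of_mem hkl hx hx'))
  · exact .inl (dyadicCube_subset_of_mem hkl hx' hx)

theorem laverage_restrict_eq_toReal {α : Type*} [MeasurableSpace α] {μ : Measure α} {Q : Set α}
    {f : α → ℝ} (hf : Measurable f) :
    ((μ Q).toReal)⁻¹ * ∫ y in Q, |f y| ∂μ = (⨍⁻ y in Q, ENNReal.ofReal |f y| ∂μ).toReal := by
  rw [setLAverage_eq, ENNReal.toReal_div, div_eq_inv_mul,
    integral_eq_lintegral_of_nonneg_ae (Filter.Eventually.of_forall fun y => abs_nonneg _)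
      (by fun_prop)]

theorem essInf_le_essInf_restrict_of_bounded {α : Type*} [MeasurableSpace α] {μ : Measure α}
    {p : α → ℝ} (hp : ∀ x, 1 ≤ p x) {P : ℝ} (hP : ∀ᵐ x ∂μ, p x ≤ P) {Q : Set α}
    (hQ : μ Q ≠ 0) : essInf p μ ≤ essInf p (μ.restrict Q) := by
  have : NeZero (μ.restrict Q) := ⟨fun h => hQ (Measure.restrict_eq_zero.1 h)⟩
  refine essInf_antitone_measure Measure.restrict_le_self.absolutelyContinuous
    (Filter.isBoundedUnder_of ⟨1, hp⟩) ?_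
  have : Filter.IsBoundedUnder (· ≤ ·) (ae (μ.restrict Q)) p :=
    ⟨P, by simpa using ae_restrict_of_ae hP⟩
  exact this.isCoboundedUnder_ge

theorem ae_mem_essInf_essSup_restrict {α : Type*} [MeasurableSpace α] {μ : Measure α}
    {p : α → ℝ} (hp : ∀ x, 1 ≤ p x) {P : ℝ} (hP : ∀ᵐ x ∂μ, p x ≤ P) (Q : Set α) :
    ∀ᵐ x ∂μ.restrict Q, essInf p (μ.restrict Q) ≤ p x ∧ p x ≤ essSup p (μ.restrict Q) :=
  (ae_essInf_le (Filter.isBoundedUnder_of ⟨1, hp⟩)).and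
    (ae_le_essSup ⟨P, by simpa using ae_restrict_of_ae hP⟩)

/-- The main pointwise estimate on a single cube. -/
theorem epsAvg_rpow_le {n : ℕ} {ε : Set (Fin n → ℝ) → ℝ} {Q : Set (Fin n → ℝ)}
    (hQm : MeasurableSet Q) (hQ0 : volume Q ≠ 0) (hQfin : volume Q ≠ ∞) (hε : 0 < ε Q)
    {B P C s : ℝ} (hεB : ε Q ≤ B) (hB : 1 ≤ B) {p : (Fin n → ℝ) → ℝ} (hpMeas : Measurable p)
    (hp1 : ∀ x, 1 ≤ p x) (hP : ∀ᵐ x ∂volume, p x ≤ P) (hs : 1 < s) (hsp : s = essInf p volume)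
    (hC : ((volume Q).toReal / ε Q) ^
        (essInf p (volume.restrict Q) - essSup p (volume.restrict Q)) ≤ C)
    {f : (Fin n → ℝ) → ℝ} (hf : Measurable f) (hf0 : ∀ x, 0 ≤ f x)
    (hf1 : ∀ᵐ x ∂volume, f x ≠ 0 → 1 < f x)
    (hmod : (∫⁻ x, ENNReal.ofReal (f x ^ p x) ∂volume) ≤ 1) :
    ∀ᵐ x ∂volume, x ∈ Q → epsAvg n ε f Q ^ p x ≤ B ^ P * max 1 C *
      (⨍⁻ y in Q, ENNReal.ofReal (f y ^ (p y / s)) ∂volume).toReal ^ s := by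
  set q := essInf p (volume.restrict Q) with hq
  set r := essSup p (volume.restrict Q) with hr
  have hsq : s ≤ q := hsp ▸ essInf_le_essInf_restrict_of_bounded hp1 hP hQ0
  have hs0 : 0 < s := by linarith
  have hq0 : 0 < q := by linarith
  have hqr := ae_mem_essInf_essSup_restrict hp1 hP Q
  have hle : ∀ {g : (Fin n → ℝ) → ℝ}, (∀ᵐ y ∂volume, g y ≤ f y ^ p y) →
      ⨍⁻ y in Q, ENNReal.ofReal (g y) ∂volume ≤ (volume Q)⁻¹ := by
    intro g hg
    rw [setLAverage_eq, ENNReal.div_eq_inv_mul]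
    refine mul_le_of_le_one_right' (le_trans ?_ hmod)
    exact (setLIntegral_le_lintegral _ _).trans
      (lintegral_mono_ae (hg.mono fun y hy => ENNReal.ofReal_le_ofReal hy))
  have hfp : ∀ᵐ y ∂volume, |f y| ≤ f y ^ p y := by
    filter_upwards [hf1] with y hy
    rw [abs_of_nonneg (hf0 y)]
    by_cases h : f y = 0
    · rw [h, Real.zero_rpow (by linarith [hp1 y])]
    · simpa using Real.rpow_le_rpow_of_exponent_le (hy h).le (hp1 y)
  have hFp : ∀ᵐ y ∂volume, f y ^ (p y / s) ≤ f y ^ p y := by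
    filter_upwards [hf1] with y hy
    have := hp1 y
    by_cases h : f y = 0
    · rw [h, Real.zero_rpow (by positivity), Real.zero_rpow (by positivity)]
    · exact Real.rpow_le_rpow_of_exponent_le (hy h).le (div_le_self (by linarith) hs.le)
  have hinv : (volume Q)⁻¹ ≠ ∞ := ENNReal.inv_ne_top.2 hQ0
  have hX : (⨍⁻ y in Q, ENNReal.ofReal |f y| ∂volume).toReal ^ q ≤
      (⨍⁻ y in Q, ENNReal.ofReal (f y ^ (p y / s)) ∂volume).toReal ^ s := by
    rw [ENNReal.toReal_rpow, ENNReal.toReal_rpow]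
    refine ENNReal.toReal_mono (ENNReal.rpow_ne_top_of_nonneg hs0.le
      ((hle hFp).trans_lt hinv.lt_top).ne) ?_
    refine rpow_laverage_le_of_le_rpow (by simpa using hQ0) (by simpa using hQfin)
      (by fun_prop) hs0 hsq ?_
    filter_upwards [hqr, ae_restrict_of_ae hf1] with y hy hfy
    rw [ENNReal.ofReal_rpow_of_nonneg (Real.rpow_nonneg (hf0 y) _) (by positivity)]
    refine ENNReal.ofReal_le_ofReal ?_
    rw [← Real.rpow_mul (hf0 y), abs_of_nonneg (hf0 y),
      show p y / s * (s / q) = p y / q by field_simp]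
    have := hp1 y
    by_cases h : f y = 0
    · rw [h, Real.zero_rpow (by positivity)]
    · simpa using Real.rpow_le_rpow_of_exponent_le (hfy h).le ((one_le_div hq0).2 hy.1)
  have hAv : (⨍⁻ y in Q, ENNReal.ofReal |f y| ∂volume).toReal ≤ ((volume Q).toReal)⁻¹ := by
    rw [← ENNReal.toReal_inv]
    exact ENNReal.toReal_mono hinv (hle hfp)
  filter_upwards [(ae_restrict_iff' hQm).1 hqr, hP] with x hx hxP hxQ
  rw [epsAvg, laverage_restrict_eq_toReal hf]
  exact mul_rpow_le_of_rpow_le (ENNReal.toReal_pos hQ0 hQfin) hε hεB hB ENNReal.toReal_nonneg hAv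
    (hs.le.trans hsq) (hx hxQ).1 (hx hxQ).2 hxP hC hX

/-- **The `f₁` estimate in the proof of Theorem 1.1:** if `ε` is bounded, positive,
with the domination property, `p ∈ εLH_0(ℝⁿ)` with `1 < p_- ≤ p_+ < ∞`, then there
is a constant `C` such that for every nonnegative `f` with `f > 1` a.e. on its
support and modular `∫ f^{p(x)} dx ≤ 1`, the modular of `M_ε f` is at most `C`. -/
theorem epsMax_modular_bound_big (n : ℕ) (ε : Set (Fin n → ℝ) → ℝ)
    (hεpos : ∀ Q, IsDyadicCube n Q → 0 < ε Q)
    (hεbdd : ∃ B : ℝ, ∀ Q, IsDyadicCube n Q → ε Q ≤ B)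
    (hεdom : ∀ P Q, IsDyadicCube n P → IsDyadicCube n Q → P ⊆ Q → ε P ≤ ε Q)
    (p : (Fin n → ℝ) → ℝ) (hpMeas : Measurable p) (hp1 : ∀ x, 1 ≤ p x)
    (hpminus : 1 < essInf p volume)
    (hpplus : ∃ B : ℝ, ∀ᵐ x ∂volume, p x ≤ B)
    (hLH0 : ∃ C0 : ℝ, 0 < C0 ∧ ∀ Q, IsDyadicCube n Q →
      ((volume Q).toReal / ε Q) ^
        (essInf p (volume.restrict Q) - essSup p (volume.restrict Q)) ≤ C0) :
    ∃ C : ℝ, 0 < C ∧ ∀ f : (Fin n → ℝ) → ℝ, Measurable f → (∀ x, 0 ≤ f x) →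
      (∀ᵐ x ∂volume, f x ≠ 0 → 1 < f x) →
      (∫⁻ x, ENNReal.ofReal (f x ^ p x) ∂volume) ≤ 1 →
      (∫⁻ x, ENNReal.ofReal (epsMax n ε f x ^ p x) ∂volume) ≤ ENNReal.ofReal C := by
  obtain ⟨B₀, hB₀⟩ := hεbdd
  obtain ⟨P, hP⟩ := hpplus
  obtain ⟨C₀, -, hC₀⟩ := hLH0
  set s := essInf p volume with hs
  set B := max 1 B₀ with hB
  have hB1 : 1 ≤ B := le_max_left _ _
  set K := B ^ P * max 1 C₀ with hK
  have hK0 : 0 < K := by positivity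
  have hs1 : 0 < s - 1 := by linarith
  have hs0 : 0 < s := by linarith
  refine ⟨K * (s * 2 ^ s / (s - 1)), by positivity, fun f hf hf0 hf1 hmod => ?_⟩
  let Q : ℤ × (Fin n → ℤ) → Set (Fin n → ℝ) := fun i => dyadicCube n i.1 i.2
  have hQm : ∀ i, MeasurableSet (Q i) := fun i => measurableSet_dyadicCube n i.1 i.2
  have hQfin : ∀ i, volume (Q i) ≠ ∞ := fun i => volume_dyadicCube_ne_top n i.1 i.2
  have hQd : ∀ i, IsDyadicCube n (Q i) := fun i => ⟨i.1, i.2, rfl⟩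
  let F : (Fin n → ℝ) → ℝ := fun y => f y ^ (p y / s)
  have hF : Measurable F := by fun_prop
  have hF0 : ∀ y, 0 ≤ F y := fun y => Real.rpow_nonneg (hf0 y) _
  let a : ℤ × (Fin n → ℤ) → NNReal :=
    fun i => (⨍⁻ y in Q i, ENNReal.ofReal (F y) ∂volume).toNNReal
  have ha : ∀ i, a i * volume (Q i) ≤ ∫⁻ y in Q i, ENNReal.ofReal (F y) ∂volume := by
    intro i
    calc _ ≤ (⨍⁻ y in Q i, ENNReal.ofReal (F y) ∂volume) * volume (Q i) := by
          gcongr; exact ENNReal.coe_toNNReal_le_self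
      _ ≤ _ := by
          rw [setLAverage_eq,
            ENNReal.div_mul_cancel (volume_dyadicCube_ne_zero n i.1 i.2) (hQfin i)]
  let G : Finset (ℤ × (Fin n → ℤ)) → (Fin n → ℝ) → NNReal :=
    fun S x => S.sup fun i => (Q i).indicator (fun _ => a i) x
  have hG : ∀ S, Measurable (G S) := fun S => measurable_finsetSup_indicator hQm a S
  have hpt : ∀ᵐ x ∂volume, ENNReal.ofReal (epsMax n ε f x ^ p x) ≤
      ENNReal.ofReal K * ⨆ S, ENNReal.ofReal ((G S x : ℝ) ^ s) := by
    have hcube : ∀ᵐ x ∂volume, ∀ i, x ∈ Q i → epsAvg n ε f (Q i) ^ p x ≤ K * (a i : ℝ) ^ s :=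
      ae_all_iff.2 fun i => epsAvg_rpow_le (hQm i) (volume_dyadicCube_ne_zero n i.1 i.2) (hQfin i)
        (hεpos _ (hQd i)) ((hB₀ _ (hQd i)).trans (le_max_right _ _)) hB1 hpMeas hp1 hP hpminus rfl
        (hC₀ _ (hQd i)) hf hf0 hf1 hmod
    filter_upwards [hcube] with x hx
    have hpx : 0 < p x := by linarith [hp1 x]
    set R := ⨆ S, ENNReal.ofReal ((G S x : ℝ) ^ s) with hR
    by_cases hRtop : R = ∞
    · rw [hRtop, ENNReal.mul_top (by simpa using hK0)]
      exact le_top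
    have haR : ∀ i, x ∈ Q i → (a i : ℝ) ^ s ≤ R.toReal := by
      intro i hi
      rw [← ENNReal.ofReal_le_iff_le_toReal hRtop]
      refine le_trans ?_ (le_iSup (fun S => ENNReal.ofReal ((G S x : ℝ) ^ s)) {i})
      simp [G, indicator_of_mem hi]
    have hKR : 0 ≤ K * R.toReal := by positivity
    have hmax : epsMax n ε f x ≤ (K * R.toReal) ^ (p x)⁻¹ := by
      refine Real.sSup_le ?_ (Real.rpow_nonneg hKR _)
      rintro _ ⟨_, ⟨k, m, rfl⟩, hxQ, rfl⟩
      have h0 : 0 ≤ epsAvg n ε f (Q (k, m)) :=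
        mul_nonneg (hεpos _ (hQd (k, m))).le (mul_nonneg (inv_nonneg.2 ENNReal.toReal_nonneg)
          (integral_nonneg fun y => abs_nonneg _))
      rw [Real.le_rpow_inv_iff_of_pos h0 hKR hpx]
      exact (hx (k, m) hxQ).trans (mul_le_mul_of_nonneg_left (haR (k, m) hxQ) hK0.le)
    have hmax0 : 0 ≤ epsMax n ε f x := by
      refine Real.sSup_nonneg ?_
      rintro _ ⟨_, hQ', -, rfl⟩
      exact mul_nonneg (hεpos _ hQ').le (mul_nonneg (inv_nonneg.2 ENNReal.toReal_nonneg)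
          (integral_nonneg fun y => abs_nonneg _))
    rw [Real.le_rpow_inv_iff_of_pos hmax0 hKR hpx] at hmax
    refine (ENNReal.ofReal_le_ofReal hmax).trans_eq ?_
    rw [ENNReal.ofReal_mul hK0.le, ENNReal.ofReal_toReal hRtop]
  have hmono : Monotone fun S x => ENNReal.ofReal ((G S x : ℝ) ^ s) := by
    intro S T hST x
    have : G S x ≤ G T x := Finset.sup_mono hST
    dsimp only
    gcongr
  have hFs : ∫⁻ x, ENNReal.ofReal (F x ^ s) ∂volume ≤ 1 := by
    refine le_trans (le_of_eq (lintegral_congr fun x => ?_)) hmod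
    rw [← Real.rpow_mul (hf0 x), div_mul_cancel₀ _ hs0.ne']
  calc _ ≤ ∫⁻ x, ENNReal.ofReal K * ⨆ S, ENNReal.ofReal ((G S x : ℝ) ^ s) ∂volume :=
        lintegral_mono_ae hpt
    _ = ENNReal.ofReal K * ⨆ S, ∫⁻ x, ENNReal.ofReal ((G S x : ℝ) ^ s) ∂volume := by
        rw [lintegral_const_mul' _ _ ofReal_ne_top,
          lintegral_iSup_directed (fun S => by fun_prop) hmono.directed_le]
    _ ≤ ENNReal.ofReal K * ENNReal.ofReal (s * 2 ^ s / (s - 1)) := by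
        gcongr
        refine iSup_le fun S => ?_
        refine (lintegral_sup_indicator_rpow_le hQm hQfin
          (fun i j => dyadicCube_laminar i.1 j.1 i.2 j.2) hF hF0 ha hpminus S).trans ?_
        exact mul_le_of_le_one_right' hFs
    _ = _ := (ENNReal.ofReal_mul hK0.le).symm
end
end

section
/- Let ε = {ε_Q}_{Q∈𝒟} be a collection of positive real numbers indexed by the dyadic cubes of ℝⁿ, bounded above and with the domination property, and let p be an exponent function with 1 < p_- ≤ p_+ < ∞ and p ∈ LH_∞(ℝⁿ). Then there exists a constant C = C(n, p(·), ε) such that for every measurable f with 0 ≤ f(x) ≤ 1 for a.e. x, one has ∫_{ℝⁿ} (M_ε f(x))^{p(x)} dx ≤ C (∫_{ℝⁿ} f(x)^{p(x)} dx + 1). -/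
open MeasureTheory Set ENNReal

noncomputable section

/-- The index `m` for which `x` lies in `dyadicCube n k m`. -/
def dyadicIndex (n : ℕ) (k : ℤ) (x : Fin n → ℝ) : Fin n → ℤ :=
  fun i => ⌊(2 : ℝ) ^ k * x i⌋

theorem mem_dyadicCube_iff {n : ℕ} {k : ℤ} {m : Fin n → ℤ} {x : Fin n → ℝ} :
    x ∈ dyadicCube n k m ↔ dyadicIndex n k x = m := by
  have h2 : (0 : ℝ) < 2 ^ k := by positivity
  simp only [dyadicCube, mem_ofPred_eq, dyadicIndex, funext_iff, Int.floor_eq_iff, zpow_neg]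
  refine forall_congr' fun i => ?_
  rw [inv_mul_le_iff₀ h2, lt_inv_mul_iff₀ h2]

theorem dyadicCube_eq_preimage (n : ℕ) (k : ℤ) (m : Fin n → ℤ) :
    dyadicCube n k m = dyadicIndex n k ⁻¹' {m} := by
  ext x
  exact mem_dyadicCube_iff

theorem measurable_dyadicIndex (n : ℕ) (k : ℤ) : Measurable (dyadicIndex n k) :=
  measurable_pi_lambda _ fun i =>
    Int.measurable_floor.comp ((measurable_pi_apply i).const_mul _)

theorem volume_dyadicCube (n : ℕ) (k : ℤ) (m : Fin n → ℤ) :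
    volume (dyadicCube n k m) = ENNReal.ofReal (2 ^ (-k)) ^ n := by
  have h : dyadicCube n k m = Set.pi univ fun i =>
      Ico ((2 : ℝ) ^ (-k) * m i) ((2 : ℝ) ^ (-k) * (m i + 1)) := by
    ext x
    simp [dyadicCube]
  rw [h, Real.volume_pi_Ico]
  simp [mul_add]

/-- The dyadic index at a fine scale determines the index at every coarser scale. -/
theorem dyadicIndex_eq_of_le {n : ℕ} {j k : ℤ} (hjk : j ≤ k) {x y : Fin n → ℝ}
    (h : dyadicIndex n k x = dyadicIndex n k y) : dyadicIndex n j x = dyadicIndex n j y := by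
  obtain ⟨d, rfl⟩ := Int.le.dest hjk
  have key : ∀ z : Fin n → ℝ, ∀ i,
      dyadicIndex n j z i = dyadicIndex n (j + d) z i / ((2 ^ d : ℕ) : ℤ) := by
    intro z i
    simp only [dyadicIndex]
    rw [← Int.floor_div_natCast]
    congr 1
    rw [zpow_add₀ two_ne_zero]
    push_cast
    rw [zpow_natCast]
    field_simp
  funext i
  rw [key, key, h]

/-- The average of `F` over the dyadic cube of side length `2^(-k)` containing `x`. -/
def dyadicAvg (n : ℕ) (F : (Fin n → ℝ) → ℝ≥0∞) (k : ℤ) (x : Fin n → ℝ) : ℝ≥0∞ :=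
  (volume (dyadicCube n k (dyadicIndex n k x)))⁻¹ *
    ∫⁻ y in dyadicCube n k (dyadicIndex n k x), F y

/-- The dyadic maximal function of `F`. -/
def dyadicMax (n : ℕ) (F : (Fin n → ℝ) → ℝ≥0∞) (x : Fin n → ℝ) : ℝ≥0∞ :=
  ⨆ k : ℤ, dyadicAvg n F k x

theorem dyadicAvg_congr_index {n : ℕ} {F : (Fin n → ℝ) → ℝ≥0∞} {k : ℤ} {x y : Fin n → ℝ}
    (h : dyadicIndex n k x = dyadicIndex n k y) : dyadicAvg n F k x = dyadicAvg n F k y := by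
  simp only [dyadicAvg, h]

theorem measurable_dyadicAvg (n : ℕ) (F : (Fin n → ℝ) → ℝ≥0∞) (k : ℤ) :
    Measurable (dyadicAvg n F k) :=
  (measurable_of_countable fun m : Fin n → ℤ =>
    (volume (dyadicCube n k m))⁻¹ * ∫⁻ y in dyadicCube n k m, F y).comp
      (measurable_dyadicIndex n k)

theorem measurable_dyadicMax (n : ℕ) (F : (Fin n → ℝ) → ℝ≥0∞) : Measurable (dyadicMax n F) :=
  Measurable.iSup fun k => measurable_dyadicAvg n F k

theorem dyadicAvg_le_const {n : ℕ} {F : (Fin n → ℝ) → ℝ≥0∞} {c : ℝ≥0∞}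
    (hF : ∀ᵐ x, F x ≤ c) (k : ℤ) (x : Fin n → ℝ) : dyadicAvg n F k x ≤ c := by
  rw [dyadicAvg, mul_comm, ← div_eq_mul_inv]
  refine ENNReal.div_le_of_le_mul ?_
  calc ∫⁻ y in dyadicCube n k (dyadicIndex n k x), F y
      ≤ ∫⁻ _ in dyadicCube n k (dyadicIndex n k x), c :=
        lintegral_mono_ae (ae_restrict_of_ae hF)
    _ = _ := by rw [setLIntegral_const]

theorem dyadicMax_le_const {n : ℕ} {F : (Fin n → ℝ) → ℝ≥0∞} {c : ℝ≥0∞}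
    (hF : ∀ᵐ x, F x ≤ c) (x : Fin n → ℝ) : dyadicMax n F x ≤ c :=
  iSup_le fun k => dyadicAvg_le_const hF k x

theorem dyadicAvg_mono {n : ℕ} {F G : (Fin n → ℝ) → ℝ≥0∞} (h : ∀ x, F x ≤ G x) (k : ℤ)
    (x : Fin n → ℝ) : dyadicAvg n F k x ≤ dyadicAvg n G k x := by
  unfold dyadicAvg
  gcongr
  exact h _

theorem dyadicAvg_add_const {n : ℕ} (F : (Fin n → ℝ) → ℝ≥0∞) (c : ℝ≥0∞) (k : ℤ)
    (x : Fin n → ℝ) : dyadicAvg n (fun y => F y + c) k x = dyadicAvg n F k x + c := by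
  unfold dyadicAvg
  rw [lintegral_add_right _ measurable_const, setLIntegral_const, mul_add, mul_left_comm,
    ENNReal.inv_mul_cancel (volume_dyadicCube_ne_zero n k _) (volume_dyadicCube_ne_top n k _),
    mul_one]

/-- A union of dyadic cubes of one scale on which the averages exceed `t`. -/
theorem mul_volume_le_of_saturated {n : ℕ} {F : (Fin n → ℝ) → ℝ≥0∞} {k : ℤ} {t : ℝ≥0∞}
    {E : Set (Fin n → ℝ)}
    (hsat : ∀ x y, dyadicIndex n k x = dyadicIndex n k y → x ∈ E → y ∈ E)
    (hE : ∀ x ∈ E, t < dyadicAvg n F k x) : t * volume E ≤ ∫⁻ x in E, F x := by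
  set T := dyadicIndex n k '' E with hT
  have hEeq : E = ⋃ m ∈ T, dyadicCube n k m := by
    simp only [dyadicCube_eq_preimage, Set.biUnion_preimage_singleton]
    refine (subset_preimage_image _ _).antisymm ?_
    rintro y ⟨x, hx, hxy⟩
    exact hsat x y hxy hx
  have hdisj : T.PairwiseDisjoint (dyadicCube n k) := by
    intro a _ b _ hab
    refine Set.disjoint_left.2 fun x hxa hxb => hab ?_
    rw [← mem_dyadicCube_iff.1 hxa, ← mem_dyadicCube_iff.1 hxb]
  rw [hEeq, measure_biUnion T.to_countable hdisj fun m _ => measurableSet_dyadicCube n k m,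
    lintegral_biUnion T.to_countable (fun m _ => measurableSet_dyadicCube n k m) hdisj,
    ← ENNReal.tsum_mul_left]
  refine ENNReal.tsum_le_tsum ?_
  rintro ⟨m, x, hx, rfl⟩
  have h := (hE x hx).le
  rw [dyadicAvg, mul_comm, ← div_eq_mul_inv] at h
  exact ENNReal.mul_le_of_le_div h

theorem mul_volume_lt_dyadicMax_le (n : ℕ) (F : (Fin n → ℝ) → ℝ≥0∞) (t : ℝ≥0∞) :
    t * volume {x | t < dyadicMax n F x} ≤ ∫⁻ x, F x := by
  set G : ℤ → Set (Fin n → ℝ) := fun k => {x | t < dyadicAvg n F k x} with hG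
  have hGm : ∀ k, MeasurableSet (G k) := fun k =>
    measurableSet_lt measurable_const (measurable_dyadicAvg n F k)
  have hfine : ∀ K : ℤ, t * volume (⋃ j : ℕ, G (j - K)) ≤ ∫⁻ x, F x := by
    intro K
    set g : ℕ → Set (Fin n → ℝ) := fun j => G (j - K) with hg
    have hm : ∀ j, MeasurableSet (disjointed g j) :=
      fun j => MeasurableSet.disjointed (fun i => hGm _) j
    rw [← iUnion_disjointed, measure_iUnion (disjoint_disjointed g) hm, ← ENNReal.tsum_mul_left]
    refine le_trans ?_ (setLIntegral_le_lintegral (⋃ j, disjointed g j) F)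
    rw [lintegral_iUnion hm (disjoint_disjointed g)]
    refine ENNReal.tsum_le_tsum fun j => ?_
    refine mul_volume_le_of_saturated (k := (j : ℤ) - K) ?_ fun x hx => disjointed_subset g j hx
    intro x y hxy hx
    have hiff : ∀ i ≤ j, x ∈ g i ↔ y ∈ g i := by
      intro i hi
      have : dyadicAvg n F ((i : ℤ) - K) x = dyadicAvg n F ((i : ℤ) - K) y :=
        dyadicAvg_congr_index (dyadicIndex_eq_of_le (by lia) hxy)
      simp only [hg, hG, mem_ofPred_eq, this]
    rw [disjointed_eq_inter_compl] at hx ⊢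
    simp only [mem_inter_iff, mem_iInter, mem_compl_iff] at hx ⊢
    exact ⟨(hiff j le_rfl).1 hx.1, fun i hi => fun h => hx.2 i hi ((hiff i hi.le).2 h)⟩
  have hunion : {x | t < dyadicMax n F x} = ⋃ K : ℕ, ⋃ j : ℕ, G (j - K) := by
    ext x
    simp only [dyadicMax, mem_ofPred_eq, lt_iSup_iff, mem_iUnion, hG]
    constructor
    · rintro ⟨k, hk⟩
      refine ⟨k.natAbs, (k + k.natAbs).toNat, ?_⟩
      have : (((k + k.natAbs).toNat : ℕ) : ℤ) - (k.natAbs : ℤ) = k := by lia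
      rwa [this]
    · rintro ⟨K, j, h⟩
      exact ⟨_, h⟩
  have hmono : Monotone fun K : ℕ => ⋃ j : ℕ, G (j - K) := by
    intro K L hKL
    refine iUnion_subset fun j => ?_
    refine subset_iUnion_of_subset (j + (L - K)) ?_
    have : (((j + (L - K) : ℕ) : ℤ) - (L : ℤ)) = (j : ℤ) - K := by lia
    rw [this]
  rw [hunion, hmono.measure_iUnion, ENNReal.mul_iSup]
  exact iSup_le fun K => hfine K

/-- The weak-type bound for the dyadic maximal function after truncating `F` at height `t`. -/
theorem mul_volume_lt_dyadicMax_le_setLIntegral (n : ℕ) {F : (Fin n → ℝ) → ℝ≥0∞}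
    (hF : Measurable F) (t : ℝ≥0∞) :
    t * volume {x | t + t < dyadicMax n F x} ≤ ∫⁻ x in {x | t < F x}, F x := by
  have hms : MeasurableSet {x | t < F x} := measurableSet_lt measurable_const hF
  rw [← lintegral_indicator hms]
  refine le_trans ?_ (mul_volume_lt_dyadicMax_le n _ t)
  gcongr t * volume ?_
  intro x hx
  simp only [dyadicMax, lt_iSup_iff] at hx ⊢
  obtain ⟨k, hk⟩ := hx
  refine ⟨k, lt_of_add_lt_add_right (hk.trans_le ?_)⟩
  rw [← dyadicAvg_add_const]
  refine dyadicAvg_mono (fun y => ?_) k x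
  by_cases hy : t < F y
  · rw [indicator_of_mem (by exact hy)]
    exact le_self_add
  · exact (not_lt.1 hy).trans le_add_self

/-- The strong-type `(q, q)` bound for the dyadic maximal function. -/
theorem lintegral_dyadicMax_rpow_le {n : ℕ} {q : ℝ} (hq : 1 < q) {f : (Fin n → ℝ) → ℝ}
    (hf : Measurable f) (hf01 : ∀ᵐ x, 0 ≤ f x ∧ f x ≤ 1) :
    ∫⁻ x, ENNReal.ofReal ((dyadicMax n (fun y => ENNReal.ofReal (f y)) x).toReal ^ q) ≤
      ENNReal.ofReal q * (2 * ((ENNReal.ofReal (q - 1))⁻¹ * ENNReal.ofReal (2 ^ (q - 1)))) *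
        ∫⁻ x, ENNReal.ofReal (f x ^ q) := by
  set F : (Fin n → ℝ) → ℝ≥0∞ := fun y => ENNReal.ofReal (f y) with hF
  have hFm : Measurable F := hf.ennreal_ofReal
  have hF1 : ∀ᵐ x, F x ≤ 1 := hf01.mono fun x hx => ENNReal.ofReal_le_one.2 hx.2
  have hMtop : ∀ x, dyadicMax n F x ≠ ∞ := fun x =>
    ne_top_of_le_ne_top ENNReal.one_ne_top (dyadicMax_le_const hF1 x)
  set ν : Measure (Fin n → ℝ) := volume.withDensity F with hν
  have hq1 : 0 < q - 1 := by linarith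
  have hlayer := lintegral_rpow_eq_lintegral_meas_lt_mul ν (f := fun x => 2 * f x)
    ((withDensity_absolutelyContinuous volume F).ae_le (hf01.mono fun x hx => by
      have := hx.1
      simp only [Pi.zero_apply]
      positivity)) (hf.const_mul 2).aemeasurable hq1
  have hν_int : ∫⁻ x, ENNReal.ofReal ((2 * f x) ^ (q - 1)) ∂ν =
      ENNReal.ofReal (2 ^ (q - 1)) * ∫⁻ x, ENNReal.ofReal (f x ^ q) := by
    rw [hν, lintegral_withDensity_eq_lintegral_mul _ hFm (by fun_prop),
      ← lintegral_const_mul' _ _ ENNReal.ofReal_ne_top]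
    refine lintegral_congr_ae (hf01.mono fun x hx => ?_)
    simp only [Pi.mul_apply, hF]
    rw [← ENNReal.ofReal_mul hx.1, ← ENNReal.ofReal_mul (by positivity),
      Real.mul_rpow zero_le_two hx.1]
    congr 1
    rcases hx.1.eq_or_lt with h0 | h0
    · rw [← h0, Real.zero_rpow (zero_lt_one.trans hq).ne']
      simp
    · rw [Real.rpow_sub_one h0.ne']
      field_simp
  have hlevel : ∀ t ∈ Ioi (0 : ℝ),
      volume {x | t < (dyadicMax n F x).toReal} * ENNReal.ofReal (t ^ (q - 1)) ≤
        2 * (ν {x | t < 2 * f x} * ENNReal.ofReal (t ^ (q - 1 - 1))) := by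
    intro t ht
    have ht0 : (0 : ℝ) < t := ht
    have h1 : {x | t < (dyadicMax n F x).toReal} =
        {x | ENNReal.ofReal (t / 2) + ENNReal.ofReal (t / 2) < dyadicMax n F x} := by
      ext x
      simp only [mem_ofPred_eq]
      rw [← ENNReal.ofReal_add (by positivity) (by positivity), add_halves,
        ENNReal.ofReal_lt_iff_lt_toReal ht0.le (hMtop x)]
    have h2 : {x | ENNReal.ofReal (t / 2) < F x} = {x | t < 2 * f x} := by
      ext x
      simp only [mem_ofPred_eq, hF]
      rw [ENNReal.ofReal_lt_ofReal_iff_of_nonneg (by positivity), div_lt_iff₀' two_pos]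
    have h3 := mul_volume_lt_dyadicMax_le_setLIntegral n hFm (ENNReal.ofReal (t / 2))
    rw [← h1, h2, ← withDensity_apply _ (measurableSet_lt measurable_const (hf.const_mul 2))] at h3
    have h4 : ENNReal.ofReal (t ^ (q - 1)) =
        ENNReal.ofReal (t / 2) * (2 * ENNReal.ofReal (t ^ (q - 1 - 1))) := by
      rw [← ENNReal.ofReal_ofNat, ← ENNReal.ofReal_mul (by positivity),
        ← ENNReal.ofReal_mul (by positivity), Real.rpow_sub_one ht0.ne' (q - 1)]
      congr 1
      field_simp
    calc _ = ENNReal.ofReal (t / 2) * volume {x | t < (dyadicMax n F x).toReal} *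
          (2 * ENNReal.ofReal (t ^ (q - 1 - 1))) := by rw [h4]; ring
      _ ≤ ν {x | t < 2 * f x} * (2 * ENNReal.ofReal (t ^ (q - 1 - 1))) := by gcongr
      _ = _ := by ring
  rw [lintegral_rpow_eq_lintegral_meas_lt_mul volume
    (Filter.Eventually.of_forall fun x => ENNReal.toReal_nonneg)
    (measurable_dyadicMax n F).ennreal_toReal.aemeasurable (by linarith)]
  have hq1' : ENNReal.ofReal (q - 1) ≠ 0 := (ENNReal.ofReal_pos.2 hq1).ne'
  calc _ ≤ ENNReal.ofReal q * ∫⁻ t in Ioi (0 : ℝ),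
        2 * (ν {x | t < 2 * f x} * ENNReal.ofReal (t ^ (q - 1 - 1))) := by
        gcongr ENNReal.ofReal q * ?_
        exact setLIntegral_mono' measurableSet_Ioi hlevel
    _ = ENNReal.ofReal q * (2 * ((ENNReal.ofReal (q - 1))⁻¹ *
        ∫⁻ x, ENNReal.ofReal ((2 * f x) ^ (q - 1)) ∂ν)) := by
        rw [lintegral_const_mul' _ _ (by simp), hlayer, ← mul_assoc (ENNReal.ofReal (q - 1))⁻¹,
          ENNReal.inv_mul_cancel hq1' ENNReal.ofReal_ne_top, one_mul]
    _ = _ := by rw [hν_int]; ring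

/-- Exponents that are log-close at infinity may be exchanged at the cost of a decaying error. -/
theorem rpow_le_exp_mul_rpow_add {E : Type*} [SeminormedAddCommGroup E] {x : E}
    {y a b C N : ℝ} (hy0 : 0 ≤ y) (hy1 : y ≤ 1) (ha : 1 ≤ a) (hN : 0 ≤ N)
    (hab : |a - b| ≤ C / Real.log (Real.exp 1 + ‖x‖)) :
    y ^ a ≤ Real.exp (N * C) * y ^ b + (1 + ‖x‖) ^ (-N) := by
  have hx : 0 < 1 + ‖x‖ := by positivity
  rcases lt_or_ge y ((1 + ‖x‖) ^ (-N)) with h | h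
  · have h1 : y ^ a ≤ y := by
      simpa using Real.rpow_le_rpow_of_exponent_ge' hy0 hy1 zero_le_one ha
    have : 0 ≤ Real.exp (N * C) * y ^ b := by positivity
    linarith
  · have hR : 0 < (1 + ‖x‖) ^ (-N) := by positivity
    have hy : 0 < y := hR.trans_le h
    have he : 1 + ‖x‖ ≤ Real.exp 1 + ‖x‖ := by
      have := Real.add_one_le_exp (1 : ℝ)
      linarith
    have hL : 0 < Real.log (Real.exp 1 + ‖x‖) := by
      apply Real.log_pos
      have := Real.add_one_le_exp (1 : ℝ)
      linarith [norm_nonneg x]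
    have hlog : |Real.log y| ≤ N * Real.log (Real.exp 1 + ‖x‖) := by
      rw [abs_of_nonpos (Real.log_nonpos hy0 hy1)]
      have h2 := Real.log_le_log hR h
      rw [Real.log_rpow hx] at h2
      have h3 := mul_le_mul_of_nonneg_left (Real.log_le_log hx he) hN
      linarith
    have hprod : Real.log y * (a - b) ≤ N * C := by
      calc Real.log y * (a - b) ≤ |Real.log y * (a - b)| := le_abs_self _
        _ = |Real.log y| * |a - b| := abs_mul _ _
        _ ≤ (N * Real.log (Real.exp 1 + ‖x‖)) * (C / Real.log (Real.exp 1 + ‖x‖)) := by gcongr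
        _ = N * C := by field_simp
    have hpow : y ^ a ≤ Real.exp (N * C) * y ^ b := by
      rw [Real.rpow_def_of_pos hy, Real.rpow_def_of_pos hy, ← Real.exp_add]
      apply Real.exp_le_exp.2
      linarith [mul_sub (Real.log y) a b]
    linarith

theorem epsMax_nonneg {n : ℕ} {ε : Set (Fin n → ℝ) → ℝ} (hε : ∀ Q, IsDyadicCube n Q → 0 < ε Q)
    (f : (Fin n → ℝ) → ℝ) (x : Fin n → ℝ) : 0 ≤ epsMax n ε f x := by
  refine Real.sSup_nonneg ?_
  rintro r ⟨Q, hQ, -, rfl⟩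
  have h1 := (hε Q hQ).le
  have h2 : 0 ≤ ∫ y in Q, |f y| := integral_nonneg fun y => abs_nonneg _
  unfold epsAvg
  positivity

theorem epsMax_le_mul_dyadicMax {n : ℕ} {ε : Set (Fin n → ℝ) → ℝ} {B : ℝ} (hB0 : 0 ≤ B)
    (hB : ∀ Q, IsDyadicCube n Q → ε Q ≤ B) {f : (Fin n → ℝ) → ℝ} (hf : Measurable f)
    (hf01 : ∀ᵐ x, 0 ≤ f x ∧ f x ≤ 1) (x : Fin n → ℝ) :
    epsMax n ε f x ≤ B * (dyadicMax n (fun y => ENNReal.ofReal (f y)) x).toReal := by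
  have hMtop : dyadicMax n (fun y => ENNReal.ofReal (f y)) x ≠ ∞ :=
    ne_top_of_le_ne_top ENNReal.one_ne_top
      (dyadicMax_le_const (hf01.mono fun x hx => ENNReal.ofReal_le_one.2 hx.2) x)
  refine Real.sSup_le ?_ (by positivity)
  rintro r ⟨Q, ⟨k, m, rfl⟩, hx, rfl⟩
  obtain rfl := mem_dyadicCube_iff.1 hx
  have havg : (volume (dyadicCube n k (dyadicIndex n k x))).toReal⁻¹ *
      ∫ y in dyadicCube n k (dyadicIndex n k x), |f y| =
        (dyadicAvg n (fun y => ENNReal.ofReal (f y)) k x).toReal := by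
    rw [dyadicAvg, ENNReal.toReal_mul, ENNReal.toReal_inv, integral_eq_lintegral_of_nonneg_ae
      (Filter.Eventually.of_forall fun y => abs_nonneg _) (by fun_prop)]
    congr 2
    exact lintegral_congr_ae (ae_restrict_of_ae (hf01.mono fun y hy => by
      simp only [abs_of_nonneg hy.1]))
  rw [epsAvg, havg]
  exact mul_le_mul (hB _ ⟨k, _, rfl⟩)
    (ENNReal.toReal_mono hMtop (le_iSup (fun k => dyadicAvg n _ k x) k))
    ENNReal.toReal_nonneg hB0

/-- The limit exponent can be taken larger than `1` when the essential infimum is. -/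
theorem exists_one_lt_limit_exponent {n : ℕ} {p : (Fin n → ℝ) → ℝ} {s C q : ℝ} (hs : 1 < s)
    (hps : ∀ᵐ x, s ≤ p x) (hC : 0 < C)
    (hLH : ∀ x : Fin n → ℝ, |p x - q| ≤ C / Real.log (Real.exp 1 + ‖x‖)) :
    ∃ q' : ℝ, 1 < q' ∧
      ∀ x : Fin n → ℝ, |p x - q'| ≤ C / Real.log (Real.exp 1 + ‖x‖) := by
  rcases n with _ | n
  · obtain ⟨x, hx⟩ := hps.exists
    refine ⟨p x, hs.trans_le hx, fun y => ?_⟩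
    rw [Subsingleton.elim y x, sub_self, abs_zero]
    have : (1 : ℝ) ≤ Real.exp 1 + ‖x‖ := by
      linarith [Real.add_one_le_exp (1 : ℝ), norm_nonneg x]
    exact div_nonneg hC.le (Real.log_nonneg this)
  · refine ⟨q, hs.trans_le ?_, hLH⟩
    have hlim : Filter.Tendsto (fun r : ℝ => q + C / Real.log (Real.exp 1 + r)) Filter.atTop
        (nhds (q + 0)) :=
      (Filter.Tendsto.div_atTop tendsto_const_nhds
        (Real.tendsto_log_atTop.comp (Filter.tendsto_atTop_add_const_left _ _
          Filter.tendsto_id))).const_add q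
    rw [add_zero] at hlim
    refine ge_of_tendsto hlim ((Filter.eventually_ge_atTop 0).mono fun r hr => ?_)
    have hpos : volume (Metric.closedBall (0 : Fin (n + 1) → ℝ) r)ᶜ ≠ 0 := by
      rw [measure_compl Metric.isClosed_closedBall.measurableSet measure_closedBall_lt_top.ne]
      simp [measure_closedBall_lt_top.ne]
    have hfreq : ∃ᵐ x : Fin (n + 1) → ℝ, x ∈ (Metric.closedBall (0 : Fin (n + 1) → ℝ) r)ᶜ :=
      frequently_ae_mem_iff.2 hpos
    obtain ⟨x, hx, hsx⟩ := (hfreq.and_eventually hps).exists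
    have hxr : r ≤ ‖x‖ := by
      simp only [mem_compl_iff, Metric.mem_closedBall, dist_zero_right, not_le] at hx
      exact hx.le
    have he := Real.add_one_le_exp (1 : ℝ)
    have hlog : 0 < Real.log (Real.exp 1 + r) := Real.log_pos (by linarith)
    have h1 : C / Real.log (Real.exp 1 + ‖x‖) ≤ C / Real.log (Real.exp 1 + r) := by
      gcongr
    have h2 := (le_abs_self _).trans (hLH x)
    linarith

/-- **The `f₂` estimate in the proof of Theorem 1.1:** if `ε` is bounded, positive,
with the domination property, and `p ∈ LH_∞(ℝⁿ)` with `1 < p_- ≤ p_+ < ∞`, then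
there is a constant `C` such that for every measurable `f` with `0 ≤ f ≤ 1` a.e.,
`∫ (M_ε f)^{p(x)} dx ≤ C (∫ f^{p(x)} dx + 1)`. -/
theorem epsMax_modular_bound_small (n : ℕ) (ε : Set (Fin n → ℝ) → ℝ)
    (hεpos : ∀ Q, IsDyadicCube n Q → 0 < ε Q)
    (hεbdd : ∃ B : ℝ, ∀ Q, IsDyadicCube n Q → ε Q ≤ B)
    (hεdom : ∀ P Q, IsDyadicCube n P → IsDyadicCube n Q → P ⊆ Q → ε P ≤ ε Q)
    (p : (Fin n → ℝ) → ℝ) (hpMeas : Measurable p) (hp1 : ∀ x, 1 ≤ p x)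
    (hpminus : 1 < essInf p volume)
    (hpplus : ∃ B : ℝ, ∀ᵐ x ∂volume, p x ≤ B)
    (hLHinf : ∃ Cinf : ℝ, 0 < Cinf ∧ ∃ pinf : ℝ, ∀ x : Fin n → ℝ,
      |p x - pinf| ≤ Cinf / Real.log (Real.exp 1 + ‖x‖)) :
    ∃ C : ℝ, 0 < C ∧ ∀ f : (Fin n → ℝ) → ℝ, Measurable f →
      (∀ᵐ x ∂volume, 0 ≤ f x ∧ f x ≤ 1) →
      (∫⁻ x, ENNReal.ofReal (epsMax n ε f x ^ p x) ∂volume) ≤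
        ENNReal.ofReal C * ((∫⁻ x, ENNReal.ofReal (f x ^ p x) ∂volume) + 1) := by
  obtain ⟨B₀, hB₀⟩ := hεbdd
  obtain ⟨P, hP⟩ := hpplus
  obtain ⟨Cinf, hCinf, pinf, hLH⟩ := hLHinf
  have hps : ∀ᵐ x, essInf p volume ≤ p x :=
    ae_essInf_le ⟨1, Filter.eventually_map.2 (Filter.Eventually.of_forall hp1)⟩
  obtain ⟨q, hq, hpq⟩ := exists_one_lt_limit_exponent hpminus hps hCinf hLH
  set B : ℝ := max B₀ 1 with hBdef
  have hB1 : 1 ≤ B := le_max_right _ _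
  have hB : ∀ Q, IsDyadicCube n Q → ε Q ≤ B := fun Q hQ => (hB₀ Q hQ).trans (le_max_left _ _)
  set N : ℝ := n + 1 with hN
  have hN0 : 0 ≤ N := by positivity
  set R : (Fin n → ℝ) → ℝ≥0∞ := fun x => ENNReal.ofReal ((1 + ‖x‖) ^ (-N)) with hR
  have hRm : Measurable R := by fun_prop
  set Z : ℝ≥0∞ := ∫⁻ x, R x with hZ
  have hZtop : Z ≠ ∞ := (finite_integral_one_add_norm (by simp [hN])).ne
  set E : ℝ≥0∞ := ENNReal.ofReal (Real.exp (N * Cinf)) with hE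
  have hEtop : E ≠ ∞ := ENNReal.ofReal_ne_top
  set K : ℝ≥0∞ := ENNReal.ofReal (B ^ P) with hK
  have hKtop : K ≠ ∞ := ENNReal.ofReal_ne_top
  set D : ℝ≥0∞ :=
    ENNReal.ofReal q * (2 * ((ENNReal.ofReal (q - 1))⁻¹ * ENNReal.ofReal (2 ^ (q - 1)))) with hD
  have hDtop : D ≠ ∞ := by
    have : ENNReal.ofReal (q - 1) ≠ 0 := (ENNReal.ofReal_pos.2 (by linarith)).ne'
    finiteness
  have hmodular : ∀ (g : (Fin n → ℝ) → ℝ) (a b : (Fin n → ℝ) → ℝ),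
      (∀ᵐ x, 0 ≤ g x ∧ g x ≤ 1) → (∀ x, 1 ≤ a x) →
      (∀ x, |a x - b x| ≤ Cinf / Real.log (Real.exp 1 + ‖x‖)) →
      ∫⁻ x, ENNReal.ofReal (g x ^ a x) ≤ E * (∫⁻ x, ENNReal.ofReal (g x ^ b x)) + Z := by
    intro g a b hg ha hab
    rw [← lintegral_const_mul' _ _ hEtop, hZ, ← lintegral_add_right _ hRm]
    refine lintegral_mono_ae (hg.mono fun x hx => ?_)
    have hgb : 0 ≤ g x ^ b x := Real.rpow_nonneg hx.1 _
    rw [hE, hR, ← ENNReal.ofReal_mul (by positivity),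
      ← ENNReal.ofReal_add (by positivity) (by positivity)]
    exact ENNReal.ofReal_le_ofReal (rpow_le_exp_mul_rpow_add hx.1 hx.2 (ha x) hN0 (hab x))
  set A : ℝ≥0∞ := K * (E * (D * E)) + (K * (E * (D * Z)) + K * Z) with hA
  have hAtop : A ≠ ∞ := by finiteness
  refine ⟨A.toReal + 1, by positivity, fun f hf hf01 => ?_⟩
  set M : (Fin n → ℝ) → ℝ :=
    fun x => (dyadicMax n (fun y => ENNReal.ofReal (f y)) x).toReal with hM
  have hM0 : ∀ x, 0 ≤ M x := fun x => ENNReal.toReal_nonneg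
  have hM1 : ∀ x, M x ≤ 1 := fun x => ENNReal.toReal_le_of_le_ofReal zero_le_one (by
    rw [ENNReal.ofReal_one]
    exact dyadicMax_le_const (hf01.mono fun x hx => ENNReal.ofReal_le_one.2 hx.2) x)
  set X : ℝ≥0∞ := ∫⁻ x, ENNReal.ofReal (f x ^ p x) with hX
  calc ∫⁻ x, ENNReal.ofReal (epsMax n ε f x ^ p x)
      ≤ K * ∫⁻ x, ENNReal.ofReal (M x ^ p x) := by
        rw [← lintegral_const_mul' _ _ hKtop]
        refine lintegral_mono_ae (hP.mono fun x hx => ?_)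
        have hMp : 0 ≤ M x ^ p x := Real.rpow_nonneg (hM0 x) _
        rw [hK, ← ENNReal.ofReal_mul (by positivity)]
        refine ENNReal.ofReal_le_ofReal ?_
        calc epsMax n ε f x ^ p x ≤ (B * M x) ^ p x :=
              Real.rpow_le_rpow (epsMax_nonneg hεpos f x)
                (epsMax_le_mul_dyadicMax (by positivity) hB hf hf01 x) (by linarith [hp1 x])
          _ = B ^ p x * M x ^ p x := Real.mul_rpow (by positivity) (hM0 x)
          _ ≤ B ^ P * M x ^ p x := by
              gcongr
    _ ≤ K * (E * (∫⁻ x, ENNReal.ofReal (M x ^ q)) + Z) := by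
        gcongr
        exact hmodular M p (fun _ => q)
          (Filter.Eventually.of_forall fun x => ⟨hM0 x, hM1 x⟩) hp1 hpq
    _ ≤ K * (E * (D * ∫⁻ x, ENNReal.ofReal (f x ^ q)) + Z) := by
        gcongr
        exact lintegral_dyadicMax_rpow_le hq hf hf01
    _ ≤ K * (E * (D * (E * X + Z)) + Z) := by
        gcongr
        exact hmodular f (fun _ => q) p hf01 (fun _ => hq.le)
          fun x => by rw [abs_sub_comm]; exact hpq x
    _ = K * (E * (D * E)) * X + (K * (E * (D * Z)) + K * Z) * 1 := by ring
    _ ≤ A * X + A * 1 := by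
        gcongr
        · exact le_self_add
        · exact le_add_self
    _ = A * (X + 1) := by ring
    _ ≤ ENNReal.ofReal (A.toReal + 1) * (X + 1) := by
        gcongr
        rw [← ENNReal.ofReal_toReal hAtop]
        refine ENNReal.ofReal_le_ofReal ?_
        rw [ENNReal.ofReal_toReal hAtop]
        linarith
end
end

section
/- Let ε = {ε_Q}_{Q∈𝒟} be a collection of positive real numbers indexed by the dyadic cubes of ℝⁿ, bounded above with ‖ε‖_∞ = sup_{Q∈𝒟} ε_Q, and with the domination property. Let Q_0 be a dyadic cube and let f be a bounded measurable function supported in Q_0. Then for almost every x ∉ Q_0, ε_{Q_0} M^d f(x) ≤ M_ε f(x) ≤ ‖ε‖_∞ M^d f(x), where M^d is the dyadic maximal operator. -/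
open MeasureTheory Set ENNReal

noncomputable section

/-- Two dyadic cubes that meet are nested: the one of smaller side length lies in the other. -/
lemma dyadicCube_subset_of_mem_s14 {n : ℕ} {k l : ℤ} {m p : Fin n → ℤ} (hlk : l ≤ k)
    {y : Fin n → ℝ} (hy : y ∈ dyadicCube n k m) (hy' : y ∈ dyadicCube n l p) :
    dyadicCube n k m ⊆ dyadicCube n l p := by
  obtain ⟨d, rfl⟩ : ∃ d : ℕ, k = l + d := ⟨(k - l).toNat, by omega⟩
  have hpos : (0 : ℝ) < 2 ^ (-(l + d : ℤ)) := by positivity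
  have hscale : (2 : ℝ) ^ (-l) = 2 ^ (-(l + d : ℤ)) * ((2 ^ d : ℤ) : ℝ) := by
    push_cast
    rw [← zpow_natCast, ← zpow_add₀ (by norm_num)]
    congr 1
    ring
  intro x hx i
  have hyi := hy i
  have hyi' := hy' i
  have hxi := hx i
  rw [hscale, mul_assoc, mul_assoc] at hyi' ⊢
  have hlow : 2 ^ d * p i ≤ m i := by
    have h := lt_of_mul_lt_mul_left (hyi'.1.trans_lt hyi.2) hpos.le
    exact Int.lt_add_one_iff.mp (by exact_mod_cast h)
  have hupp : m i + 1 ≤ 2 ^ d * (p i + 1) := by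
    have h := lt_of_mul_lt_mul_left (hyi.1.trans_lt hyi'.2) hpos.le
    exact Int.add_one_le_iff.mpr (by exact_mod_cast h)
  constructor
  · refine le_trans (mul_le_mul_of_nonneg_left ?_ hpos.le) hxi.1
    exact_mod_cast hlow
  · refine hxi.2.trans_le (mul_le_mul_of_nonneg_left ?_ hpos.le)
    exact_mod_cast hupp

lemma IsDyadicCube.subset_or_subset {n : ℕ} {P Q : Set (Fin n → ℝ)} (hP : IsDyadicCube n P)
    (hQ : IsDyadicCube n Q) (h : (P ∩ Q).Nonempty) : P ⊆ Q ∨ Q ⊆ P := by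
  obtain ⟨k, m, rfl⟩ := hP
  obtain ⟨l, p, rfl⟩ := hQ
  obtain ⟨y, hyP, hyQ⟩ := h
  rcases le_total l k with hlk | hkl
  · exact Or.inl (dyadicCube_subset_of_mem_s14 hlk hyP hyQ)
  · exact Or.inr (dyadicCube_subset_of_mem_s14 hkl hyQ hyP)

lemma exists_isDyadicCube_mem (n : ℕ) (x : Fin n → ℝ) : ∃ Q, IsDyadicCube n Q ∧ x ∈ Q :=
  ⟨dyadicCube n 0 fun i => ⌊x i⌋, ⟨0, _, rfl⟩, fun i => by
    simpa using And.intro (Int.floor_le (x i)) (Int.lt_floor_add_one (x i))⟩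

lemma epsAvg_eq_mul (n : ℕ) (ε : Set (Fin n → ℝ) → ℝ) (f : (Fin n → ℝ) → ℝ)
    (Q : Set (Fin n → ℝ)) : epsAvg n ε f Q = ε Q * epsAvg n (fun _ => 1) f Q := by
  simp [epsAvg]

lemma epsAvg_one_nonneg (n : ℕ) (f : (Fin n → ℝ) → ℝ) (Q : Set (Fin n → ℝ)) :
    0 ≤ epsAvg n (fun _ => 1) f Q := by
  have : 0 ≤ ∫ y in Q, |f y| := integral_nonneg fun _ => abs_nonneg _
  unfold epsAvg
  positivity

lemma epsAvg_one_le {n : ℕ} {f : (Fin n → ℝ) → ℝ} {M : ℝ} (hM : ∀ x, |f x| ≤ M)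
    (Q : Set (Fin n → ℝ)) : epsAvg n (fun _ => 1) f Q ≤ M := by
  have hM0 : 0 ≤ M := (abs_nonneg _).trans (hM 0)
  rw [epsAvg, one_mul]
  rcases eq_or_ne (volume Q).toReal 0 with h | h
  · simpa [h] using hM0
  · have hfin : volume Q < ∞ := lt_top_iff_ne_top.mpr fun htop => h (by simp [htop])
    have hnorm : ∀ y ∈ Q, ‖|f y|‖ ≤ M := fun y _ => by simpa using hM y
    have hint : ∫ y in Q, |f y| ≤ M * (volume Q).toReal :=
      (le_abs_self _).trans (norm_setIntegral_le_of_norm_le_const hfin hnorm)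
    rw [inv_mul_le_iff₀ (lt_of_le_of_ne toReal_nonneg h.symm)]
    linarith

/-- **The ε-maximal operator is pointwise equivalent to the dyadic maximal operator
away from the support:** if `ε = {ε_Q}` is a bounded collection of positive numbers
with the domination property, `Q₀` is a dyadic cube, and `f` is bounded and supported
in `Q₀`, then for a.e. `x ∉ Q₀`,
`ε_{Q₀} M^d f(x) ≤ M_ε f(x) ≤ ‖ε‖_∞ M^d f(x)`. -/
theorem epsMax_equiv_dyadicMax_away (n : ℕ) (ε : Set (Fin n → ℝ) → ℝ)
    (hεpos : ∀ Q, IsDyadicCube n Q → 0 < ε Q)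
    (hεbdd : ∃ B : ℝ, ∀ Q, IsDyadicCube n Q → ε Q ≤ B)
    (hεdom : ∀ P Q, IsDyadicCube n P → IsDyadicCube n Q → P ⊆ Q → ε P ≤ ε Q)
    (Q₀ : Set (Fin n → ℝ)) (hQ₀ : IsDyadicCube n Q₀)
    (f : (Fin n → ℝ) → ℝ) (hfMeas : Measurable f)
    (hfbdd : ∃ M : ℝ, ∀ x, |f x| ≤ M)
    (hfsupp : ∀ x, x ∉ Q₀ → f x = 0) :
    ∀ᵐ x ∂volume, x ∉ Q₀ →
      ε Q₀ * epsMax n (fun _ => 1) f x ≤ epsMax n ε f x ∧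
      epsMax n ε f x ≤
        sSup {r : ℝ | ∃ Q, IsDyadicCube n Q ∧ r = ε Q} * epsMax n (fun _ => 1) f x := by
  obtain ⟨B, hB⟩ := hεbdd
  obtain ⟨M, hM⟩ := hfbdd
  refine Filter.Eventually.of_forall fun x hx => ?_
  obtain ⟨R, hR, hxR⟩ := exists_isDyadicCube_mem n x
  have hbdd_one :
      BddAbove {r : ℝ | ∃ Q, IsDyadicCube n Q ∧ x ∈ Q ∧ r = epsAvg n (fun _ => 1) f Q} := by
    refine ⟨M, ?_⟩
    rintro r ⟨Q, -, -, rfl⟩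
    exact epsAvg_one_le hM Q
  have hbdd : BddAbove {r : ℝ | ∃ Q, IsDyadicCube n Q ∧ x ∈ Q ∧ r = epsAvg n ε f Q} := by
    refine ⟨B * M, ?_⟩
    rintro r ⟨Q, hQ, -, rfl⟩
    rw [epsAvg_eq_mul]
    exact mul_le_mul (hB Q hQ) (epsAvg_one_le hM Q) (epsAvg_one_nonneg n f Q)
      ((hεpos Q hQ).le.trans (hB Q hQ))
  have hle : ∀ Q, IsDyadicCube n Q → x ∈ Q → ε Q * epsAvg n (fun _ => 1) f Q ≤ epsMax n ε f x :=
    fun Q hQ hxQ => le_csSup hbdd ⟨Q, hQ, hxQ, (epsAvg_eq_mul n ε f Q).symm⟩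
  constructor
  · rw [← le_div_iff₀' (hεpos Q₀ hQ₀)]
    refine csSup_le ⟨_, R, hR, hxR, rfl⟩ ?_
    rintro r ⟨Q, hQ, hxQ, rfl⟩
    rw [le_div_iff₀' (hεpos Q₀ hQ₀)]
    refine le_trans ?_ (hle Q hQ hxQ)
    rcases (Q₀ ∩ Q).eq_empty_or_nonempty with hdisj | hmeet
    · have hzero : ∫ y in Q, |f y| = 0 := by
        refine setIntegral_eq_zero_of_forall_eq_zero fun y hy => ?_
        rw [hfsupp y fun hy₀ => hdisj.subset ⟨hy₀, hy⟩, abs_zero]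
      simp [epsAvg, hzero]
    · have hsub : Q₀ ⊆ Q :=
        (hQ₀.subset_or_subset hQ hmeet).resolve_right fun h => hx (h hxQ)
      exact mul_le_mul_of_nonneg_right (hεdom Q₀ Q hQ₀ hQ hsub) (epsAvg_one_nonneg n f Q)
  · refine csSup_le ⟨_, R, hR, hxR, rfl⟩ ?_
    rintro r ⟨Q, hQ, hxQ, rfl⟩
    rw [epsAvg_eq_mul]
    have hsup : ε Q ≤ sSup {r : ℝ | ∃ Q, IsDyadicCube n Q ∧ r = ε Q} := by
      refine le_csSup ⟨B, ?_⟩ ⟨Q, hQ, rfl⟩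
      rintro r ⟨P, hP, rfl⟩
      exact hB P hP
    exact mul_le_mul hsup (le_csSup hbdd_one ⟨Q, hQ, hxQ, rfl⟩) (epsAvg_one_nonneg n f Q)
      ((hεpos Q hQ).le.trans hsup)
end
end

section
/- Fix 0 < a < 1 and define p : ℝ → [1,∞) by p(x) = 2 for x ≤ 0, p(x) = 2 + (log₂(2/x))^{−a} for 0 < x < 1, and p(x) = 3 for x ≥ 1. Fix C ≥ 1 and for n ≥ 0 set Q_n = [0, 2^{−n}) and Q_n' = [2^{−n−1}, 2^{−n}). Let ε = {ε_Q}_{Q∈𝒟} be any collection of positive real numbers indexed by the dyadic intervals of ℝ satisfying: ε_{Q_n} ≤ 2^{−n} C^{(n+1)^a} for all n ≥ 0; ε_{Q_n'} = ε_{Q_n} for all n ≥ 0; and ε_Q = C for all other dyadic intervals Q. Then p ∈ εLH_0(ℝ), i.e. there is a constant C' such that (|Q|/ε_Q)^{p_-(Q) − p_+(Q)} ≤ C' for every dyadic interval Q. -/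
open MeasureTheory Set ENNReal

noncomputable section

/-- The dyadic interval `[2^{-k} m, 2^{-k}(m+1))` in `ℝ`. -/
def dyadicInterval (k m : ℤ) : Set ℝ :=
  Set.Ico ((2 : ℝ) ^ (-k) * m) ((2 : ℝ) ^ (-k) * (m + 1))

/-- The exponent function of Section 5: `p(x) = 2` for `x ≤ 0`,
`p(x) = 2 + (log₂(2/x))^{-a}` for `0 < x < 1`, and `p(x) = 3` for `x ≥ 1`. -/
def pEx (a : ℝ) (x : ℝ) : ℝ :=
  if x ≤ 0 then 2 else if x < 1 then 2 + Real.logb 2 (2 / x) ^ (-a) else 3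

lemma volume_dyadicInterval (k m : ℤ) :
    volume (dyadicInterval k m) = ENNReal.ofReal ((2 : ℝ) ^ (-k)) := by
  rw [dyadicInterval, Real.volume_Ico]
  congr 1
  ring

/-- The essential oscillation of a function with values in `[c, d]` on a set of positive measure
lies in `[0, d - c]`. -/
lemma essInf_sub_essSup_mem_Icc {f : ℝ → ℝ} {s : Set ℝ} (hs : MeasurableSet s)
    (hs0 : volume s ≠ 0) {c d : ℝ} (h : ∀ x ∈ s, f x ∈ Set.Icc c d) :
    essInf f (volume.restrict s) - essSup f (volume.restrict s) ∈ Set.Icc (c - d) 0 := by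
  have : (ae (volume.restrict s)).NeBot := by
    rw [ae_neBot]
    simpa [Measure.restrict_eq_zero] using hs0
  have hc : ∀ᵐ x ∂volume.restrict s, c ≤ f x :=
    (ae_restrict_iff' hs).2 (ae_of_all _ fun x hx => (h x hx).1)
  have hd : ∀ᵐ x ∂volume.restrict s, f x ≤ d :=
    (ae_restrict_iff' hs).2 (ae_of_all _ fun x hx => (h x hx).2)
  have hbc : Filter.IsBoundedUnder (· ≥ ·) (ae (volume.restrict s)) f := ⟨c, by simpa using hc⟩
  have hbd : Filter.IsBoundedUnder (· ≤ ·) (ae (volume.restrict s)) f := ⟨d, by simpa using hd⟩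
  have h1 : c ≤ essInf f (volume.restrict s) :=
    Filter.le_liminf_of_le hbd.isCoboundedUnder_ge hc
  have h2 : essSup f (volume.restrict s) ≤ d :=
    Filter.limsup_le_of_le hbc.isCoboundedUnder_le hd
  have h3 : essInf f (volume.restrict s) ≤ essSup f (volume.restrict s) :=
    Filter.liminf_le_limsup hbd hbc
  constructor <;> linarith

lemma Real.rpow_le_rpow_of_inv_le_of_mem_Icc {r R t d : ℝ} (hr : 0 < r) (hR : 1 ≤ R)
    (hrR : r⁻¹ ≤ R) (ht : t ∈ Set.Icc (-d) 0) : r ^ t ≤ R ^ d := by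
  have h : r ^ t = r⁻¹ ^ (-t) := by rw [Real.inv_rpow hr.le, Real.rpow_neg hr.le, inv_inv]
  rw [h]
  exact (Real.rpow_le_rpow (inv_nonneg.2 hr.le) hrR (by linarith [ht.2])).trans
    (Real.rpow_le_rpow_of_exponent_le hR (by linarith [ht.1]))

lemma one_le_logb_two_div {x : ℝ} (hx : 0 < x) (hx1 : x ≤ 1) : 1 ≤ Real.logb 2 (2 / x) := by
  rw [Real.le_logb_iff_rpow_le one_lt_two (by positivity), Real.rpow_one, le_div_iff₀ hx]
  linarith

lemma logb_two_div_rpow_neg_le {a x y : ℝ} (ha : 0 < a) (hx : 0 < x) (hxy : x ≤ y)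
    (hy : y ≤ 1) : Real.logb 2 (2 / x) ^ (-a) ≤ Real.logb 2 (2 / y) ^ (-a) := by
  have hy0 : 0 < y := hx.trans_le hxy
  refine Real.rpow_le_rpow_of_nonpos (by linarith [one_le_logb_two_div hy0 hy]) ?_ (by linarith)
  exact Real.logb_le_logb_of_le one_lt_two (by positivity) (by gcongr)

lemma two_le_pEx (a x : ℝ) : 2 ≤ pEx a x := by
  unfold pEx
  split_ifs with h0 h1
  · exact le_rfl
  · have := one_le_logb_two_div (not_le.1 h0) h1.le
    have := Real.rpow_nonneg (zero_le_one.trans this) (-a)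
    linarith
  · norm_num

lemma pEx_le_three {a : ℝ} (ha : 0 < a) (x : ℝ) : pEx a x ≤ 3 := by
  unfold pEx
  split_ifs with h0 h1
  · norm_num
  · have := Real.rpow_le_one_of_one_le_of_nonpos (one_le_logb_two_div (not_le.1 h0) h1.le)
      (neg_nonpos.2 ha.le)
    linarith
  · exact le_rfl

lemma pEx_le_of_lt {a x y : ℝ} (ha : 0 < a) (hy0 : 0 < y) (hy : y ≤ 1) (hxy : x < y) :
    pEx a x ≤ 2 + Real.logb 2 (2 / y) ^ (-a) := by
  unfold pEx
  split_ifs with h0 h1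
  · have := Real.rpow_nonneg (zero_le_one.trans (one_le_logb_two_div hy0 hy)) (-a)
    linarith
  · linarith [logb_two_div_rpow_neg_le ha (not_le.1 h0) hxy.le hy]
  · linarith

lemma le_pEx_of_le {a x y : ℝ} (ha : 0 < a) (hy : 0 < y) (hyx : y ≤ x) (hx : x < 1) :
    2 + Real.logb 2 (2 / y) ^ (-a) ≤ pEx a x := by
  rw [pEx, if_neg (by linarith), if_pos hx]
  linarith [logb_two_div_rpow_neg_le ha hy hyx hx.le]

lemma logb_two_div_two_zpow_mul (k : ℤ) {m : ℝ} (hm : 0 < m) :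
    Real.logb 2 (2 / (2 ^ (-k) * m)) = 1 + k - Real.logb 2 m := by
  rw [Real.logb_div two_ne_zero (by positivity), Real.logb_mul (by positivity) hm.ne',
    ← Real.rpow_intCast, Real.logb_rpow two_pos (by norm_num), Real.logb_self_eq_one one_lt_two]
  push_cast
  ring

lemma rpow_neg_sub_rpow_neg_le {a A B : ℝ} (ha0 : 0 < a) (ha1 : a ≤ 1) (hA : 1 ≤ A)
    (hAB : A ≤ B) : A ^ (-a) - B ^ (-a) ≤ (B - A) / B := by
  have hA0 : 0 < A := by linarith
  have hB0 : 0 < B := by linarith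
  have h1 : A ^ (-a) ≤ 1 := Real.rpow_le_one_of_one_le_of_nonpos hA (by linarith)
  have h2 : A / B ≤ (A / B) ^ a :=
    Real.self_le_rpow_of_le_one (by positivity) ((div_le_one hB0).2 hAB) ha1
  have h3 : (A / B) ^ a ≤ 1 :=
    Real.rpow_le_one (by positivity) ((div_le_one hB0).2 hAB) ha0.le
  have h4 : B ^ (-a) = A ^ (-a) * (A / B) ^ a := by
    rw [Real.div_rpow hA0.le hB0.le, Real.rpow_neg hA0.le, Real.rpow_neg hB0.le]
    have : A ^ a ≠ 0 := (Real.rpow_pos_of_pos hA0 a).ne'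
    field_simp
  have h5 : (B - A) / B = 1 - A / B := by field_simp
  rw [h4, h5]
  nlinarith

/-- The oscillation of `p` over `[2^{-k} m, 2^{-k} (m+1)) ⊆ (0, 1)` is `O(1 / k)`. -/
lemma mul_pEx_oscillation_le {a : ℝ} (ha0 : 0 < a) (ha1 : a ≤ 1) {k : ℤ} {m : ℝ}
    (hm : 1 ≤ m) (hmk : 2 ^ (-k) * (m + 1) ≤ (1 : ℝ)) :
    (k : ℝ) * (Real.logb 2 (2 / (2 ^ (-k) * (m + 1))) ^ (-a) -
      Real.logb 2 (2 / (2 ^ (-k) * m)) ^ (-a)) ≤ 6 := by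
  have hm0 : 0 < m := by linarith
  have hA := one_le_logb_two_div (x := 2 ^ (-k) * (m + 1)) (by positivity) hmk
  have hlog0 : 0 ≤ Real.logb 2 m := Real.logb_nonneg one_lt_two hm
  have hlog2 : (1 / 2 : ℝ) < Real.log 2 := by linarith [Real.log_two_gt_d9]
  have hlogm : Real.logb 2 m ≤ 2 * m := by
    rw [Real.logb, div_le_iff₀ (by linarith)]
    nlinarith [Real.log_le_sub_one_of_pos hm0]
  have hdiff0 : Real.logb 2 m ≤ Real.logb 2 (m + 1) :=
    Real.logb_le_logb_of_le one_lt_two hm0 (by linarith)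
  have hdiff : m * (Real.logb 2 (m + 1) - Real.logb 2 m) ≤ 2 := by
    rw [← Real.logb_div (by positivity) hm0.ne', Real.logb, mul_div_assoc',
      div_le_iff₀ (by linarith)]
    have := Real.log_le_sub_one_of_pos (x := (m + 1) / m) (by positivity)
    have h : (m + 1) / m - 1 = 1 / m := by field_simp; ring
    rw [h, le_div_iff₀ hm0] at this
    linarith
  rw [logb_two_div_two_zpow_mul k (by positivity)] at hA ⊢
  rw [logb_two_div_two_zpow_mul k hm0]
  set A := 1 + (k : ℝ) - Real.logb 2 (m + 1) with hAdef
  set B := 1 + (k : ℝ) - Real.logb 2 m with hBdef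
  have hAB : A ≤ B := by linarith
  have hB : 1 ≤ B := hA.trans hAB
  have hk : 0 ≤ (k : ℝ) := by linarith
  have hmBA : m * (B - A) ≤ 2 := by
    rw [show B - A = Real.logb 2 (m + 1) - Real.logb 2 m by rw [hAdef, hBdef]; ring]
    exact hdiff
  refine (mul_le_mul_of_nonneg_left (rpow_neg_sub_rpow_neg_le ha0 ha1 hA hAB) hk).trans ?_
  rw [mul_div_assoc', div_le_iff₀ (by linarith)]
  have hkB : (k : ℝ) ≤ 3 * m * B := by nlinarith
  calc (k : ℝ) * (B - A) ≤ 3 * m * B * (B - A) := by gcongr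
    _ = 3 * B * (m * (B - A)) := by ring
    _ ≤ 3 * B * 2 := by gcongr
    _ = 6 * B := by ring

/-- If the values of `f` on a dyadic interval lie in `[c, d]`, a bound `e / |Q| ≤ R` with `1 ≤ R`
gives a bound for the expression in the `εLH_0` condition. -/
lemma dyadicInterval_rpow_essInf_sub_essSup_le {f : ℝ → ℝ} {k m : ℤ} {c d e R : ℝ}
    (h : ∀ x ∈ dyadicInterval k m, f x ∈ Set.Icc c d) (he : 0 < e) (hR : 1 ≤ R)
    (heR : e * 2 ^ k ≤ R) :
    ((volume (dyadicInterval k m)).toReal / e) ^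
      (essInf f (volume.restrict (dyadicInterval k m)) -
        essSup f (volume.restrict (dyadicInterval k m))) ≤ R ^ (d - c) := by
  have hpos : (0 : ℝ) < 2 ^ (-k) := by positivity
  have hmem := essInf_sub_essSup_mem_Icc (s := dyadicInterval k m) measurableSet_Ico
    (by rw [volume_dyadicInterval]; simpa using hpos) h
  rw [volume_dyadicInterval, ENNReal.toReal_ofReal hpos.le]
  refine Real.rpow_le_rpow_of_inv_le_of_mem_Icc (by positivity) hR ?_ (by simpa using hmem)
  rw [inv_div, zpow_neg, div_inv_eq_mul]
  exact heR

/-- **Section 5 (the example is in `εLH_0(ℝ)`).**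
Fix `0 < a < 1` and `C ≥ 1`. Let `Q_n = [0, 2^{-n})` and `Q_n' = [2^{-n-1}, 2^{-n})`
for `n ≥ 0`, and let `ε = {ε_Q}` be any collection of positive numbers with
`ε_{Q_n} ≤ 2^{-n} C^{(n+1)^a}`, `ε_{Q_n'} = ε_{Q_n}`, and `ε_Q = C` for all other
dyadic intervals `Q`. Then `p ∈ εLH_0(ℝ)`:
`(|Q|/ε_Q)^{p_-(Q) - p_+(Q)} ≤ C'` for all dyadic intervals `Q`. -/
theorem pEx_mem_epsLH0 (a : ℝ) (ha0 : 0 < a) (ha1 : a < 1)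
    (C : ℝ) (hC : 1 ≤ C) (ε : Set ℝ → ℝ)
    (hεpos : ∀ k m : ℤ, 0 < ε (dyadicInterval k m))
    (hQn : ∀ n : ℕ, ε (dyadicInterval n 0) ≤
      2 ^ (-(n : ℤ)) * C ^ (((n : ℝ) + 1) ^ a))
    (hQn' : ∀ n : ℕ, ε (dyadicInterval ((n : ℤ) + 1) 1) = ε (dyadicInterval n 0))
    (hOther : ∀ k m : ℤ,
      (∀ n : ℕ, dyadicInterval k m ≠ dyadicInterval n 0 ∧
        dyadicInterval k m ≠ dyadicInterval ((n : ℤ) + 1) 1) →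
      ε (dyadicInterval k m) = C) :
    ∃ C' : ℝ, 0 < C' ∧ ∀ k m : ℤ,
      ((volume (dyadicInterval k m)).toReal / ε (dyadicInterval k m)) ^
        (essInf (pEx a) (volume.restrict (dyadicInterval k m)) -
          essSup (pEx a) (volume.restrict (dyadicInterval k m))) ≤ C' := by
  have hC0 : 0 < C := by linarith
  have near_zero : ∀ (n : ℕ) (k m : ℤ), k ≤ n + 1 →
      (2 : ℝ) ^ (-k) * (m + 1) = 2 ^ (-(n : ℤ)) →
      ε (dyadicInterval k m) = ε (dyadicInterval n 0) →
      ((volume (dyadicInterval k m)).toReal / ε (dyadicInterval k m)) ^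
        (essInf (pEx a) (volume.restrict (dyadicInterval k m)) -
          essSup (pEx a) (volume.restrict (dyadicInterval k m))) ≤ 64 * C := by
    intro n k m hk hend hε
    have hn1 : (1 : ℝ) ≤ n + 1 := by simp
    have hna : 1 ≤ C ^ (((n : ℝ) + 1) ^ a) := Real.one_le_rpow hC (by positivity)
    refine (dyadicInterval_rpow_essInf_sub_essSup_le (c := 2)
      (d := 2 + ((n : ℝ) + 1) ^ (-a)) (R := 2 * C ^ (((n : ℝ) + 1) ^ a)) ?_
      (hεpos k m) (by linarith) ?_).trans ?_
    · intro x hx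
      refine ⟨two_le_pEx a x, ?_⟩
      have hx2 : x < 2 ^ (-(n : ℤ)) := hend ▸ hx.2
      have h := pEx_le_of_lt ha0 (by positivity)
        (zpow_le_one_of_nonpos₀ one_le_two (by simp)) hx2
      have hlog := logb_two_div_two_zpow_mul n one_pos
      rw [mul_one, Real.logb_one, sub_zero] at hlog
      rw [hlog] at h
      simpa [add_comm] using h
    · rw [hε]
      calc ε (dyadicInterval n 0) * 2 ^ k
          ≤ 2 ^ (-(n : ℤ)) * C ^ (((n : ℝ) + 1) ^ a) * 2 ^ ((n : ℤ) + 1) :=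
            mul_le_mul (hQn n) (zpow_le_zpow_right₀ one_le_two hk) (by positivity)
              (by positivity)
        _ = 2 * C ^ (((n : ℝ) + 1) ^ a) := by
            rw [zpow_add₀ two_ne_zero, zpow_neg, zpow_one]
            field_simp
    · have hexp : ((n : ℝ) + 1) ^ (-a) ≤ 1 :=
        Real.rpow_le_one_of_one_le_of_nonpos hn1 (by linarith)
      have h2 : (2 : ℝ) ^ (((n : ℝ) + 1) ^ (-a)) ≤ 2 := by
        simpa using Real.rpow_le_rpow_of_exponent_le one_le_two hexp
      rw [add_sub_cancel_left, Real.mul_rpow zero_le_two (by positivity), ← Real.rpow_mul hC0.le,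
        ← Real.rpow_add (by positivity), add_neg_cancel, Real.rpow_zero, Real.rpow_one]
      nlinarith
  refine ⟨64 * C, by positivity, fun k m => ?_⟩
  by_cases h : ∀ n : ℕ, dyadicInterval k m ≠ dyadicInterval n 0 ∧
      dyadicInterval k m ≠ dyadicInterval ((n : ℤ) + 1) 1
  swap
  · simp only [not_forall, not_and_or, not_not] at h
    obtain ⟨n, h | h⟩ := h
    · rw [h]
      exact near_zero n n 0 (by simp) (by simp) rfl
    · rw [h]
      refine near_zero n (n + 1) 1 le_rfl ?_ (hQn' n)
      rw [neg_add, zpow_add₀ two_ne_zero]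
      norm_num
      ring
  rw [hOther k m h]
  rcases le_or_gt k 0 with hk | hk
  · refine (dyadicInterval_rpow_essInf_sub_essSup_le (c := 2) (d := 3) (R := C)
      (fun x _ => ⟨two_le_pEx a x, pEx_le_three ha0 x⟩) hC0 hC ?_).trans ?_
    · exact mul_le_of_le_one_right hC0.le (zpow_le_one_of_nonpos₀ one_le_two hk)
    · norm_num
      linarith
  have h2k : (1 : ℝ) ≤ 2 ^ k := one_le_zpow₀ one_le_two hk.le
  have hR : 1 ≤ C * 2 ^ k := one_le_mul_of_one_le_of_one_le hC h2k
  have hm0 : m ≠ 0 := by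
    rintro rfl
    lift k to ℕ using hk.le
    exact (h k).1 rfl
  have hpos : (0 : ℝ) < 2 ^ (-k) := by positivity
  rcases lt_or_gt_of_ne hm0 with hm | hm
  · have hm' : (m : ℝ) + 1 ≤ 0 := by exact_mod_cast hm
    refine (dyadicInterval_rpow_essInf_sub_essSup_le (c := 2) (d := 2)
      (fun x hx => ?_) hC0 hR le_rfl).trans ?_
    · have hx0 : x ≤ 0 := hx.2.le.trans (mul_nonpos_of_nonneg_of_nonpos hpos.le hm')
      simp [pEx, hx0]
    · rw [sub_self, Real.rpow_zero]
      linarith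
  have hm1 : (1 : ℝ) ≤ m := by exact_mod_cast hm
  rcases le_or_gt (2 ^ k.toNat) m with hmk | hmk
  · have hmk' : (2 : ℝ) ^ k ≤ m := by
      rw [← Int.toNat_of_nonneg hk.le, zpow_natCast]
      exact_mod_cast hmk
    refine (dyadicInterval_rpow_essInf_sub_essSup_le (c := 3) (d := 3)
      (fun x hx => ?_) hC0 hR le_rfl).trans ?_
    · have hx1 : 1 ≤ x := by
        refine le_trans ?_ hx.1
        rw [zpow_neg, ← div_eq_inv_mul, one_le_div (by positivity)]
        exact hmk'
      simp [pEx, not_le.2 (zero_lt_one.trans_le hx1), not_lt.2 hx1]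
    · rw [sub_self, Real.rpow_zero]
      linarith
  have hmk' : (m : ℝ) + 1 ≤ 2 ^ k := by
    rw [← Int.toNat_of_nonneg hk.le, zpow_natCast]
    exact_mod_cast hmk
  have hend : (2 : ℝ) ^ (-k) * (m + 1) ≤ 1 := by
    rw [zpow_neg, ← div_eq_inv_mul, div_le_one (by positivity)]
    exact hmk'
  have hstart : (0 : ℝ) < 2 ^ (-k) * m := by positivity
  have hle : (2 : ℝ) ^ (-k) * m ≤ 2 ^ (-k) * (m + 1) := by gcongr; linarith
  refine (dyadicInterval_rpow_essInf_sub_essSup_le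
    (fun x hx => ⟨le_pEx_of_le ha0 hstart hx.1 (hx.2.trans_le hend),
      pEx_le_of_lt ha0 (hstart.trans_le hle) hend hx.2⟩) hC0 hR le_rfl).trans ?_
  have hosc := mul_pEx_oscillation_le ha0 ha1.le hm1 hend
  rw [add_sub_add_left_eq_sub]
  set t := Real.logb 2 (2 / (2 ^ (-k) * ((m : ℝ) + 1))) ^ (-a) -
    Real.logb 2 (2 / (2 ^ (-k) * (m : ℝ))) ^ (-a) with ht
  have ht1 : t ≤ 1 := by
    have h1 := Real.rpow_le_one_of_one_le_of_nonpos
      (one_le_logb_two_div (hstart.trans_le hle) hend) (neg_nonpos.2 ha0.le)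
    have h2 := Real.rpow_nonneg
      (zero_le_one.trans (one_le_logb_two_div hstart (hle.trans hend))) (-a)
    linarith
  rw [Real.mul_rpow hC0.le (by positivity), ← Real.rpow_intCast, ← Real.rpow_mul zero_le_two,
    mul_comm]
  refine mul_le_mul ?_ ?_ (by positivity) (by norm_num)
  · refine (Real.rpow_le_rpow_of_exponent_le one_le_two hosc).trans ?_
    norm_num
  · simpa using Real.rpow_le_rpow_of_exponent_le hC ht1
end
end

section
/- Fix 0 < a < 1 and define p : ℝ → [1,∞) by p(x) = 2 for x ≤ 0, p(x) = 2 + (log₂(2/x))^{−a} for 0 < x < 1, and p(x) = 3 for x ≥ 1. Then p is not locally log-Hölder continuous: there is no constant C₀ > 0 such that |p(x) − p(y)| ≤ C₀/(−log|x−y|) for all x, y ∈ ℝ with |x − y| < 1/2. -/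
open MeasureTheory Set ENNReal

noncomputable section

/-- **Section 5 (the example is not locally log-Hölder continuous).**
For `0 < a < 1`, the exponent function `p = pEx a` is not in `LH_0(ℝ)`: there is no
constant `C₀ > 0` such that `|p(x) - p(y)| ≤ C₀ / (-log |x - y|)` whenever
`|x - y| < 1/2`. -/
theorem pEx_not_LH0 (a : ℝ) (ha0 : 0 < a) (ha1 : a < 1) :
    ¬ ∃ C₀ : ℝ, 0 < C₀ ∧ ∀ x y : ℝ, |x - y| < 1 / 2 →
      |pEx a x - pEx a y| ≤ C₀ / (-Real.log |x - y|) := by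
  rintro ⟨C, -, h⟩
  have hlog : 0 < Real.log 2 := Real.log_pos one_lt_two
  obtain ⟨t, ht, hCt⟩ := ((Filter.eventually_ge_atTop (3 : ℝ)).and
    ((tendsto_rpow_atTop (sub_pos.2 ha1)).eventually_gt_atTop (2 * C / Real.log 2))).exists
  have ht0 : 0 < t := by linarith
  have hx0 : (0 : ℝ) < 2 ^ (1 - t) := by positivity
  have hx : (2 : ℝ) ^ (1 - t) < 1 / 2 := by
    rw [one_div, ← Real.rpow_neg_one]
    exact Real.rpow_lt_rpow_of_exponent_lt one_lt_two (by linarith)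
  have hquot : (2 : ℝ) / 2 ^ (1 - t) = 2 ^ t := by
    rw [Real.rpow_sub two_pos, Real.rpow_one]
    field_simp
  have hp : pEx a (2 ^ (1 - t)) = 2 + t ^ (-a) := by
    rw [pEx, if_neg hx0.not_ge, if_pos (by linarith), hquot,
      Real.logb_rpow two_pos (by norm_num)]
  have hp0 : pEx a 0 = 2 := if_pos le_rfl
  have hb := h (2 ^ (1 - t)) 0 (by rwa [sub_zero, abs_of_pos hx0])
  rw [hp, hp0, sub_zero, abs_of_pos hx0, add_sub_cancel_left,
    abs_of_pos (Real.rpow_pos_of_pos ht0 _), Real.log_rpow two_pos,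
    le_div_iff₀ (by nlinarith)] at hb
  rw [div_lt_iff₀ hlog, sub_eq_add_neg, Real.rpow_add ht0, Real.rpow_one] at hCt
  nlinarith [mul_nonneg (mul_pos (Real.rpow_pos_of_pos ht0 (-a)) hlog).le
    (show 0 ≤ t - 2 by linarith)]
end
end
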